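/- arXiv:2205.08038 — 2 statements merged into one kernel-verified Lean document; each statement's English description precedes it below -/
import Mathlib

section
/- Consider the constrained minimization min f(x) over {x ∈ ℝⁿ : G(x) = 0, F(x) ≤ 0}, with f, G : ℝⁿ → ℝˡ, F : ℝⁿ → ℝᵐ twice continuously differentiable. Let b > 0 and let z* = (x, s, ν, λ) satisfy g(z*, b) = 0. Assume the LICQ and strict complementarity hold at z*, that J_zz f(z*) is invertible, and that J_zz f(·) is differentiable in a neighborhood of z*. Let ε : z ↦ ε(z) ≥ 0 be constant in a neighborhood of z* and satisfy inertia(J_zz f(z*) + E(z*)) = (n+m, l+m, 0). If the second-order sufficient conditions for a local minimum fail at z*, namely inertia(J_zz f(z*)) ≠ (n+m, l+m, 0), then z* is an unstable equilibrium of the primal-dual interior-point iteration z⁺ = z − (J_zz f(z) + E(z))⁻¹ S(z)⁻¹ g(z, b) (with step size α = 1 and b fixed). -/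
open Filter Topology Matrix

noncomputable section

/-- The `i`-th partial derivative of `f` at `x`. -/
def pd {n : ℕ} (f : EuclideanSpace ℝ (Fin n) → ℝ) (x : EuclideanSpace ℝ (Fin n)) (i : Fin n) : ℝ :=
  fderiv ℝ f x (EuclideanSpace.single i 1)

/-- The Hessian matrix of `f` at `x`. -/
def hessian {n : ℕ} (f : EuclideanSpace ℝ (Fin n) → ℝ) (x : EuclideanSpace ℝ (Fin n)) :
    Matrix (Fin n) (Fin n) ℝ :=
  Matrix.of fun i j => pd (fun y => pd f y j) x i

/-- The real symmetric matrix `A` has inertia `t = (n₊, n₋, n₀)`. -/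
def HasInertia {ι : Type*} [Fintype ι] [DecidableEq ι] (A : Matrix ι ι ℝ)
    (t : ℕ × ℕ × ℕ) : Prop :=
  ∃ hA : A.IsHermitian,
    Nat.card {i // 0 < hA.eigenvalues i} = t.1 ∧
    Nat.card {i // hA.eigenvalues i < 0} = t.2.1 ∧
    Nat.card {i // hA.eigenvalues i = 0} = t.2.2

/-- Lyapunov stability of a fixed point of the discrete iteration `z⁺ = T(z)`. -/
def StableFixedPt {Z : Type*} [NormedAddCommGroup Z] (T : Z → Z) (z : Z) : Prop :=
  ∀ η > 0, ∃ δ > 0, ∀ z₀, ‖z₀ - z‖ < δ → ∀ k : ℕ, ‖T^[k] z₀ - z‖ < η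

/-- An unstable fixed point: the Lyapunov stability property fails. -/
def IsUnstableFixedPt {Z : Type*} [NormedAddCommGroup Z] (T : Z → Z) (z : Z) : Prop :=
  Function.IsFixedPt T z ∧ ¬ StableFixedPt T z

variable {n l m : ℕ}

/-- The primal-dual variables `z = (x, s, ν, λ)`. -/
abbrev ZMin (n l m : ℕ) :=
  EuclideanSpace ℝ (Fin n) × (Fin m → ℝ) × (Fin l → ℝ) × (Fin m → ℝ)

/-- Index type matching the block structure `(x, s, ν, λ)`. -/
abbrev ιMin (n l m : ℕ) := (Fin n ⊕ Fin m) ⊕ (Fin l ⊕ Fin m)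

/-- The Lagrangian `L(z) = f(x) + ν'G(x) + λ'(F(x)+s)`, as a function of `x`. -/
def LagrangianMin (f : EuclideanSpace ℝ (Fin n) → ℝ) (G : EuclideanSpace ℝ (Fin n) → Fin l → ℝ)
    (F : EuclideanSpace ℝ (Fin n) → Fin m → ℝ) (z : ZMin n l m) :
    EuclideanSpace ℝ (Fin n) → ℝ :=
  fun x => f x + (∑ j, z.2.2.1 j * G x j) + ∑ i, z.2.2.2 i * (F x i + z.2.1 i)

/-- The vector `g(z,b) = (∇ₓL(z); λ⊙s − b·1; G(x); F(x)+s)`. -/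
def gMin (f : EuclideanSpace ℝ (Fin n) → ℝ) (G : EuclideanSpace ℝ (Fin n) → Fin l → ℝ)
    (F : EuclideanSpace ℝ (Fin n) → Fin m → ℝ) (z : ZMin n l m) (b : ℝ) : ιMin n l m → ℝ :=
  Sum.elim
    (Sum.elim (fun i => gradient (LagrangianMin f G F z) z.1 i)
      (fun i => z.2.2.2 i * z.2.1 i - b))
    (Sum.elim (fun j => G z.1 j) (fun i => F z.1 i + z.2.1 i))

/-- The matrix `J_zz f(z)` of the primal-dual interior-point method. -/
def JzzMin (f : EuclideanSpace ℝ (Fin n) → ℝ) (G : EuclideanSpace ℝ (Fin n) → Fin l → ℝ)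
    (F : EuclideanSpace ℝ (Fin n) → Fin m → ℝ) (z : ZMin n l m) :
    Matrix (ιMin n l m) (ιMin n l m) ℝ :=
  Matrix.fromBlocks
    (Matrix.fromBlocks (hessian (LagrangianMin f G F z) z.1) 0 0
      (Matrix.diagonal fun i => z.2.2.2 i / z.2.1 i))
    (Matrix.fromBlocks (Matrix.of fun i j => pd (fun x' => G x' j) z.1 i)
      (Matrix.of fun i j => pd (fun x' => F x' j) z.1 i) 0 1)
    (Matrix.fromBlocks (Matrix.of fun i j => pd (fun x' => G x' j) z.1 i)
      (Matrix.of fun i j => pd (fun x' => F x' j) z.1 i) 0 1)ᵀ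
    0

/-- The modification matrix `E(z) = diag(ε(z)·1ₙ, 0)`. -/
def EMin (ε : ZMin n l m → ℝ) (z : ZMin n l m) : Matrix (ιMin n l m) (ιMin n l m) ℝ :=
  Matrix.diagonal (Sum.elim (Sum.elim (fun _ => ε z) (fun _ => 0)) (fun _ => 0))

/-- The scaling matrix `S(z) = diag(1ₙ, s, 1_{l+m})`. -/
def SMin (z : ZMin n l m) : Matrix (ιMin n l m) (ιMin n l m) ℝ :=
  Matrix.diagonal (Sum.elim (Sum.elim (fun _ => 1) z.2.1) (fun _ => 1))

/-- The modified primal-dual interior-point iteration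
`z⁺ = z − (J_zz f(z) + E(z))⁻¹ S(z)⁻¹ g(z,b)`, with step size `α = 1`. -/
def ipMinMap (f : EuclideanSpace ℝ (Fin n) → ℝ) (G : EuclideanSpace ℝ (Fin n) → Fin l → ℝ)
    (F : EuclideanSpace ℝ (Fin n) → Fin m → ℝ) (ε : ZMin n l m → ℝ) (b : ℝ)
    (z : ZMin n l m) : ZMin n l m :=
  let d : ιMin n l m → ℝ :=
    (JzzMin f G F z + EMin ε z)⁻¹.mulVec ((SMin z)⁻¹.mulVec (gMin f G F z b))
  ((WithLp.equiv 2 (Fin n → ℝ)).symm fun i => z.1 i - d (Sum.inl (Sum.inl i)),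
    fun i => z.2.1 i - d (Sum.inl (Sum.inr i)),
    fun j => z.2.2.1 j - d (Sum.inr (Sum.inl j)),
    fun i => z.2.2.2 i - d (Sum.inr (Sum.inr i)))

/-- Every coefficient vector supported on `p` yields a vector whose quadratic form is diagonal in
the eigenvalues satisfying `p`. -/
theorem exists_linearMap_quadraticForm_eq_sum_eigenvalues {ι : Type*} [Fintype ι] [DecidableEq ι]
    {A : Matrix ι ι ℝ} (hA : A.IsHermitian) (p : ι → Prop) :
    ∃ φ : ({i // p i} → ℝ) →ₗ[ℝ] (ι → ℝ), ∀ c, φ c ⬝ᵥ (A *ᵥ φ c) =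
      ∑ᶠ i : {i // p i}, hA.eigenvalues i * c i ^ 2 := by
  classical
  let e : ι → ι → ℝ := fun i => (hA.eigenvectorBasis i).ofLp
  have he : ∀ i j, e i ⬝ᵥ e j = if i = j then 1 else 0 := fun i j => by
    have := orthonormal_iff_ite.mp hA.eigenvectorBasis.orthonormal j i
    simpa [EuclideanSpace.inner_eq_star_dotProduct, e, eq_comm] using this
  refine ⟨Fintype.linearCombination ℝ (fun i : {i // p i} => e i), fun c => ?_⟩
  have hAe : ∀ i, A *ᵥ e i = hA.eigenvalues i • e i := fun i => hA.mulVec_eigenvectorBasis i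
  rw [finsum_eq_sum_of_fintype]
  simp only [Fintype.linearCombination_apply, mulVec_sum, mulVec_smul, hAe, sum_dotProduct,
    dotProduct_sum, smul_dotProduct, dotProduct_smul, he, smul_eq_mul]
  refine Finset.sum_congr rfl fun i _ => ?_
  rw [Finset.sum_eq_single i]
  · simp; ring
  · intro j _ hj
    have : (j : ι) ≠ i := fun h => hj (Subtype.ext h)
    simp [this]
  · simp

/-- If a linear map sends negative directions of `J` to negative directions of `A`, then `J` has at
most as many negative eigenvalues as `A` has nonpositive ones. -/
theorem card_pos_add_card_neg_le {ι : Type*} [Fintype ι] [DecidableEq ι]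
    {A J : Matrix ι ι ℝ} (hA : A.IsHermitian) (hJ : J.IsHermitian) (K : (ι → ℝ) →ₗ[ℝ] (ι → ℝ))
    (h : ∀ v, v ⬝ᵥ (J *ᵥ v) < 0 → K v ⬝ᵥ (A *ᵥ K v) < 0) :
    Nat.card {i // 0 < hA.eigenvalues i} + Nat.card {i // hJ.eigenvalues i < 0} ≤
      Fintype.card ι := by
  classical
  obtain ⟨φ, hφ⟩ := exists_linearMap_quadraticForm_eq_sum_eigenvalues hA
    (fun i => 0 < hA.eigenvalues i)
  obtain ⟨ψ, hψ⟩ := exists_linearMap_quadraticForm_eq_sum_eigenvalues hJ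
    (fun i => hJ.eigenvalues i < 0)
  simp only [finsum_eq_sum_of_fintype] at hφ hψ
  have hinj : Function.Injective (φ.coprod (-(K ∘ₗ ψ))) := by
    rw [injective_iff_map_eq_zero]
    rintro ⟨a, c⟩ hac
    have hac' : φ a = K (ψ c) := by simpa [add_neg_eq_zero] using hac
    have h0 : 0 ≤ φ a ⬝ᵥ (A *ᵥ φ a) := by
      rw [hφ]; exact Finset.sum_nonneg fun i _ => mul_nonneg i.2.le (sq_nonneg _)
    have hc : c = 0 := by
      by_contra hc
      obtain ⟨i, hi⟩ := Function.ne_iff.mp hc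
      have hneg : ψ c ⬝ᵥ (J *ᵥ ψ c) < 0 := by
        rw [hψ]
        exact Finset.sum_neg' (fun i _ => mul_nonpos_of_nonpos_of_nonneg i.2.le (sq_nonneg _))
          ⟨i, Finset.mem_univ _, mul_neg_of_neg_of_pos i.2 (sq_pos_of_ne_zero hi)⟩
      have := h _ hneg
      rw [← hac'] at this
      exact absurd this (not_lt.mpr h0)
    have ha : a = 0 := by
      by_contra ha
      obtain ⟨i, hi⟩ := Function.ne_iff.mp ha
      have hpos : 0 < φ a ⬝ᵥ (A *ᵥ φ a) := by
        rw [hφ]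
        exact Finset.sum_pos' (fun i _ => mul_nonneg i.2.le (sq_nonneg _))
          ⟨i, Finset.mem_univ _, mul_pos i.2 (sq_pos_of_ne_zero hi)⟩
      rw [hac', hc] at hpos
      simp at hpos
    rw [ha, hc]; rfl
  simpa [Nat.card_eq_fintype_card] using LinearMap.finrank_le_finrank_of_injective hinj

theorem card_eigenvalues_trichotomy {ι : Type*} [Fintype ι] [DecidableEq ι]
    {A : Matrix ι ι ℝ} (hA : A.IsHermitian) :
    Nat.card {i // 0 < hA.eigenvalues i} + Nat.card {i // hA.eigenvalues i < 0} +
      Nat.card {i // hA.eigenvalues i = 0} = Fintype.card ι := by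
  classical
  simp only [Nat.card_eq_fintype_card, Fintype.card_subtype, ← Finset.card_univ (α := ι)]
  rw [← Finset.card_union_of_disjoint, ← Finset.card_union_of_disjoint]
  · congr 1
    ext i
    simpa [or_comm, or_assoc, or_left_comm] using lt_trichotomy (hA.eigenvalues i) 0
  · rw [Finset.disjoint_left]
    intro i
    simp only [Finset.mem_union, Finset.mem_filter, Finset.mem_univ, true_and]
    rintro (h | h) <;> linarith
  · rw [Finset.disjoint_left]
    intro i
    simp only [Finset.mem_filter, Finset.mem_univ, true_and]
    intro h
    linarith

theorem HasInertia.isUnit_det {ι : Type*} [Fintype ι] [DecidableEq ι] {A : Matrix ι ι ℝ} {p q : ℕ}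
    (h : HasInertia A (p, q, 0)) : IsUnit A.det := by
  obtain ⟨hA, -, -, h0⟩ := h
  rw [hA.det_eq_prod_eigenvalues, isUnit_iff_ne_zero]
  refine Finset.prod_ne_zero_iff.mpr fun i _ hi => ?_
  have : IsEmpty {i // hA.eigenvalues i = 0} := by
    rw [Nat.card_eq_zero] at h0
    exact h0.resolve_right fun h => h.not_finite inferInstance
  exact this.false ⟨i, by simpa using hi⟩

/-- If an invertible `A - E` and `A` have different inertia, with `A` invertible and `E` positive
semidefinite, then `E` is exceeded by `E A⁻¹ E` in some direction. -/
theorem exists_lt_of_hasInertia_sub_ne {ι : Type*} [Fintype ι] [DecidableEq ι]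
    {A E : Matrix ι ι ℝ} {p q : ℕ} {t : ℕ × ℕ × ℕ} (hA : HasInertia A (p, q, 0))
    (hE : E.PosSemidef) (hJ : HasInertia (A - E) t) (hdet : IsUnit (A - E).det)
    (ht : t ≠ (p, q, 0)) :
    ∃ v : ι → ℝ, v ⬝ᵥ (E *ᵥ v) < (E *ᵥ v) ⬝ᵥ (A⁻¹ *ᵥ (E *ᵥ v)) := by
  by_contra! hcon
  have hAdet := hA.isUnit_det
  obtain ⟨hAh, hAp, hAn, hA0⟩ := hA
  obtain ⟨hJh, hJp, hJn, hJ0⟩ := hJ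
  have hJ0' : Nat.card {i // hJh.eigenvalues i = 0} = 0 := by
    rw [hJh.det_eq_prod_eigenvalues, isUnit_iff_ne_zero, Finset.prod_ne_zero_iff] at hdet
    have : IsEmpty {i // hJh.eigenvalues i = 0} :=
      ⟨fun i => hdet i.1 (Finset.mem_univ _) (by simp [i.2])⟩
    simp
  have hEv : ∀ v : ι → ℝ, 0 ≤ v ⬝ᵥ (E *ᵥ v) := fun v => by
    simpa using hE.dotProduct_mulVec_nonneg v
  have h₁ := card_pos_add_card_neg_le hJh hAh LinearMap.id fun v hv => by
    have := hEv v
    simp only [LinearMap.id_apply, sub_mulVec, dotProduct_sub]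
    linarith
  have h₂ := card_pos_add_card_neg_le hAh hJh (A⁻¹ * (A - E)).mulVecLin fun v hv => by
    have hAA : A⁻¹ * (A - E) = 1 - A⁻¹ * E := by
      rw [mul_sub, nonsing_inv_mul _ hAdet]
    have hAAA : A * (A⁻¹ * (A - E)) = A - E := by
      rw [← mul_assoc, mul_nonsing_inv _ hAdet, one_mul]
    have hAinv : (A⁻¹ *ᵥ (E *ᵥ v)) ⬝ᵥ (A *ᵥ v) = v ⬝ᵥ (E *ᵥ v) := by
      have hAT : Aᵀ = A := hAh
      rw [dotProduct_mulVec, ← mulVec_transpose, hAT, mulVec_mulVec, mul_nonsing_inv _ hAdet,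
        one_mulVec, dotProduct_comm]
    rw [mulVecLin_apply, mulVec_mulVec, hAAA, hAA]
    rw [sub_mulVec, dotProduct_sub] at hv
    simp only [sub_mulVec, one_mulVec, sub_dotProduct, dotProduct_sub, ← mulVec_mulVec]
    rw [hAinv, dotProduct_comm (A⁻¹ *ᵥ (E *ᵥ v))]
    have := hcon v
    linarith
  have h₃ := card_eigenvalues_trichotomy hAh
  have h₄ := card_eigenvalues_trichotomy hJh
  apply ht
  refine Prod.ext ?_ (Prod.ext ?_ ?_) <;> dsimp only at * <;> omega

/-- A fixed point is not stable as soon as some quadratic form, positive somewhere, is strictly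
expanded by the linearization. -/
theorem not_stableFixedPt_of_quadratic {Z : Type*} [NormedAddCommGroup Z] [NormedSpace ℝ Z]
    {T : Z → Z} {z : Z} {M : Z →L[ℝ] Z} (hT : HasFDerivAt T M z) (hz : T z = z)
    (B : Z →L[ℝ] Z →L[ℝ] ℝ) {r c : ℝ} (hr : 1 < r) (hc : 0 < c)
    (hB : ∀ x, c * ‖x‖ ^ 2 ≤ B (M x) (M x) - r * B x x) (hpos : ∃ x, 0 < B x x) :
    ¬ StableFixedPt T z := by
  intro hst
  obtain ⟨x, hx⟩ := hpos
  set β := ‖B‖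
  have hβ : 0 ≤ β := norm_nonneg B
  have hM : 0 ≤ ‖M‖ := norm_nonneg _
  set D := β * (2 * ‖M‖ + 1)
  have hD : 0 ≤ D := by positivity
  set τ := min 1 (c / (D + 1))
  have hτ : 0 < τ := lt_min one_pos (by positivity)
  have hτ1 : τ ≤ 1 := min_le_left _ _
  have hτD : D * τ ≤ c := by
    have h : τ * (D + 1) ≤ c := (le_div_iff₀ (by positivity)).mp (min_le_right _ _)
    nlinarith
  have hev := hT.isLittleO.def hτ
  obtain ⟨η, hη, hball⟩ := Metric.eventually_nhds_iff_ball.mp hev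
  have hstep : ∀ w, ‖w - z‖ < η →
      r * B (w - z) (w - z) ≤ B (T w - z) (T w - z) := by
    intro w hw
    have he := hball w (by rwa [mem_ball_iff_norm])
    rw [hz] at he
    obtain ⟨y, hy⟩ : ∃ y, y = w - z := ⟨_, rfl⟩
    obtain ⟨e, hee⟩ : ∃ e, e = T w - z - M (w - z) := ⟨_, rfl⟩
    have hTw : T w - z = M y + e := by rw [hee, hy]; abel
    rw [← hee, ← hy] at he
    rw [hTw, ← hy]
    have h₁ : |B (M y) e| ≤ β * (‖M‖ * ‖y‖) * (τ * ‖y‖) :=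
      (B.le_opNorm₂ _ _).trans (by gcongr; exact M.le_opNorm y)
    have h₂ : |B e (M y)| ≤ β * (τ * ‖y‖) * (‖M‖ * ‖y‖) :=
      (B.le_opNorm₂ _ _).trans (by gcongr; exact M.le_opNorm y)
    have h₃ : |B e e| ≤ β * (τ * ‖y‖) * (1 * ‖y‖) :=
      (B.le_opNorm₂ _ _).trans (by gcongr; exact he.trans (by gcongr))
    have h₄ := hB y
    have h₅ : D * τ * ‖y‖ ^ 2 ≤ c * ‖y‖ ^ 2 := by gcongr
    have h₆ : D * τ * ‖y‖ ^ 2 = β * (‖M‖ * ‖y‖) * (τ * ‖y‖) + β * (τ * ‖y‖) * (‖M‖ * ‖y‖) +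
      β * (τ * ‖y‖) * (1 * ‖y‖) := by simp only [D]; ring
    simp only [map_add, _root_.add_apply]
    have := (abs_le.mp h₁).1
    have := (abs_le.mp h₂).1
    have := (abs_le.mp h₃).1
    linarith
  obtain ⟨δ, hδ, hstay⟩ := hst η hη
  set t := δ / (‖x‖ + 1)
  have ht : 0 < t := by positivity
  have hx₀ : ‖z + t • x - z‖ < δ := by
    rw [add_sub_cancel_left, norm_smul, Real.norm_of_nonneg ht.le]
    have : t * (‖x‖ + 1) = δ := div_mul_cancel₀ _ (by positivity)
    nlinarith
  set w₀ := z + t • x with hw₀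
  have hgrow : ∀ k : ℕ, r ^ k * (t ^ 2 * B x x) ≤ B (T^[k] w₀ - z) (T^[k] w₀ - z) := by
    intro k
    induction k with
    | zero =>
      simp [hw₀, pow_two, mul_assoc]
    | succ k ih =>
      rw [Function.iterate_succ_apply']
      refine le_trans ?_ (hstep _ (hstay _ hx₀ k))
      rw [pow_succ', mul_assoc]
      gcongr
  have hpos' : 0 < t ^ 2 * B x x := by positivity
  obtain ⟨k, hk⟩ := pow_unbounded_of_one_lt (β * η * η / (t ^ 2 * B x x)) hr
  rw [div_lt_iff₀ hpos'] at hk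
  have hle : B (T^[k] w₀ - z) (T^[k] w₀ - z) ≤ β * η * η := by
    refine (le_abs_self _).trans ((B.le_opNorm₂ _ _).trans ?_)
    have := (hstay _ hx₀ k).le
    gcongr
  linarith [hgrow k]

theorem Matrix.exists_mulVec_dotProduct_self_le {ι : Type*} [Fintype ι] (K : Matrix ι ι ℝ) :
    ∃ C : ℝ, 0 ≤ C ∧ ∀ v : ι → ℝ, (K *ᵥ v) ⬝ᵥ (K *ᵥ v) ≤ C * (v ⬝ᵥ v) := by
  refine ⟨∑ i, ∑ j, K i j ^ 2, by positivity, fun v => ?_⟩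
  simp only [dotProduct, mulVec, ← pow_two, Finset.sum_mul]
  refine Finset.sum_le_sum fun i _ => ?_
  rw [← Finset.sum_mul]
  exact Finset.sum_mul_sq_le_sq_mul_sq _ _ _

theorem Matrix.dotProduct_self_nonneg_real {ι : Type*} [Fintype ι] (v : ι → ℝ) : 0 ≤ v ⬝ᵥ v := by
  simpa using dotProduct_star_self_nonneg v

/-- If `M` factors through an orthogonal projection `P` on whose range it compresses to a symmetric
matrix with an eigenvalue larger than one, then `M` strictly expands an indefinite quadratic
form. -/
theorem exists_expanded_quadraticForm {ι : Type*} [Fintype ι] [DecidableEq ι]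
    {M P : Matrix ι ι ℝ} (hP : Pᵀ = P) (hMP : M * P = M)
    (hB : (P * M)ᵀ = P * M) {v : ι → ℝ}
    (hv : (P *ᵥ v) ⬝ᵥ (P *ᵥ v) < (P *ᵥ v) ⬝ᵥ ((P * M) *ᵥ v)) :
    ∃ (C : Matrix ι ι ℝ) (r c : ℝ), 1 < r ∧ 0 < c ∧
      (∀ u, c * (u ⬝ᵥ u) ≤ (M *ᵥ u) ⬝ᵥ (C *ᵥ (M *ᵥ u)) - r * (u ⬝ᵥ (C *ᵥ u))) ∧
      ∃ u, 0 < u ⬝ᵥ (C *ᵥ u) := by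
  obtain ⟨B, hBdef⟩ : ∃ B, B = P * M := ⟨_, rfl⟩
  rw [← hBdef] at hB hv
  have hBP : B * P = B := by rw [hBdef, mul_assoc, hMP]
  have hPB : P * B = B := by
    have := congrArg transpose hBP
    rwa [transpose_mul, hB, hP] at this
  have hBM : B * M = B * B := by
    nth_rewrite 1 [← hBP]
    rw [mul_assoc, ← hBdef]
  have hBsymm : ∀ u w : ι → ℝ, u ⬝ᵥ (B *ᵥ w) = (B *ᵥ u) ⬝ᵥ w := fun u w => by
    rw [dotProduct_mulVec, ← mulVec_transpose, hB]
  have hPsymm : ∀ u w : ι → ℝ, u ⬝ᵥ (P *ᵥ w) = (P *ᵥ u) ⬝ᵥ w := fun u w => by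
    rw [dotProduct_mulVec, ← mulVec_transpose, hP]
  set a := (P *ᵥ v) ⬝ᵥ (P *ᵥ v) with ha
  set β := (B *ᵥ v) ⬝ᵥ (B *ᵥ v) with hβ
  have ha0 : 0 < a := by
    refine lt_of_le_of_ne (dotProduct_self_nonneg_real _) fun h => ?_
    have : P *ᵥ v = 0 := dotProduct_self_eq_zero.mp h.symm
    rw [ha, this] at hv
    simp at hv
  have haβ : a < β := by
    have := dotProduct_self_nonneg_real (B *ᵥ v - P *ᵥ v)
    simp only [sub_dotProduct, dotProduct_sub] at this
    rw [dotProduct_comm (B *ᵥ v) (P *ᵥ v)] at this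
    linarith
  obtain ⟨r, ⟨hr1, hrβ⟩, hrs⟩ := ((Set.Ioo_infinite ((one_lt_div ha0).mpr haβ)).sdiff
    (finite_real_spectrum (A := B * B))).nonempty
  rw [lt_div_iff₀ ha0] at hrβ
  have hunit : IsUnit (r • (1 : Matrix ι ι ℝ) - B * B) := by
    simpa [spectrum.mem_iff, Algebra.algebraMap_eq_smul_one] using hrs
  have hdet := (isUnit_iff_isUnit_det _).mp hunit
  obtain ⟨K, hK0, hK⟩ := exists_mulVec_dotProduct_self_le (r • (1 : Matrix ι ι ℝ) - B * B)⁻¹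
  obtain ⟨μ, hμ0, hμ⟩ := exists_mulVec_dotProduct_self_le M
  have hvv := dotProduct_self_nonneg_real v
  obtain ⟨κ, hκ0, hκ1, hκ2⟩ : ∃ κ : ℝ, 0 < κ ∧ κ * (v ⬝ᵥ v) < β - r * a ∧ κ * (μ * K) ≤ 1 := by
    have hμK : 0 ≤ μ * K := by positivity
    have hd : 0 < β - r * a := by linarith
    refine ⟨min ((β - r * a) / (v ⬝ᵥ v + 1)) (1 / (μ * K + 1)),
      lt_min (by positivity) (by positivity), ?_, ?_⟩
    · have hp : 0 < min ((β - r * a) / (v ⬝ᵥ v + 1)) (1 / (μ * K + 1)) :=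
        lt_min (by positivity) (by positivity)
      have h := (le_div_iff₀ (by positivity)).mp
        (min_le_left ((β - r * a) / (v ⬝ᵥ v + 1)) (1 / (μ * K + 1)))
      nlinarith
    · have hp : 0 < min ((β - r * a) / (v ⬝ᵥ v + 1)) (1 / (μ * K + 1)) :=
        lt_min (by positivity) (by positivity)
      have h := (le_div_iff₀ (by positivity)).mp
        (min_le_right ((β - r * a) / (v ⬝ᵥ v + 1)) (1 / (μ * K + 1)))
      nlinarith
  have hC : ∀ u, u ⬝ᵥ ((B * B - r • (P * P) - κ • (1 : Matrix ι ι ℝ)) *ᵥ u) =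
      (B *ᵥ u) ⬝ᵥ (B *ᵥ u) - r * ((P *ᵥ u) ⬝ᵥ (P *ᵥ u)) - κ * (u ⬝ᵥ u) := fun u => by
    simp only [sub_mulVec, smul_mulVec, one_mulVec, dotProduct_sub, dotProduct_smul, smul_eq_mul,
      ← mulVec_mulVec, hBsymm, hPsymm]
  refine ⟨B * B - r • (P * P) - κ • (1 : Matrix ι ι ℝ), r, κ * r, hr1, by positivity,
    fun u => ?_, v, ?_⟩
  · rw [hC, hC]
    have e₁ : B *ᵥ (M *ᵥ u) = B *ᵥ (B *ᵥ u) := by rw [mulVec_mulVec, hBM, mulVec_mulVec]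
    have e₂ : P *ᵥ (M *ᵥ u) = B *ᵥ u := by rw [mulVec_mulVec, ← hBdef]
    have e₃ : M *ᵥ u = M *ᵥ (P *ᵥ u) := by rw [mulVec_mulVec, hMP]
    have e₄ : B *ᵥ (P *ᵥ u) = B *ᵥ u := by rw [mulVec_mulVec, hBP]
    have h₁ : (M *ᵥ u) ⬝ᵥ (M *ᵥ u) ≤ μ * ((P *ᵥ u) ⬝ᵥ (P *ᵥ u)) := by rw [e₃]; exact hμ _
    have h₂ := hK ((r • (1 : Matrix ι ι ℝ) - B * B) *ᵥ (P *ᵥ u))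
    rw [mulVec_mulVec, nonsing_inv_mul _ hdet, one_mulVec] at h₂
    have e₅ : (r • (1 : Matrix ι ι ℝ) - B * B) *ᵥ (P *ᵥ u) = r • (P *ᵥ u) - B *ᵥ (B *ᵥ u) := by
      rw [sub_mulVec, smul_mulVec, one_mulVec, ← mulVec_mulVec, e₄]
    have e₆ : (B *ᵥ (B *ᵥ u)) ⬝ᵥ (P *ᵥ u) = (B *ᵥ u) ⬝ᵥ (B *ᵥ u) := by rw [← hBsymm, e₄]
    have e₇ : (P *ᵥ u) ⬝ᵥ (B *ᵥ (B *ᵥ u)) = (B *ᵥ u) ⬝ᵥ (B *ᵥ u) := by rw [dotProduct_comm, e₆]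
    have h₃ := dotProduct_self_nonneg_real (r • (P *ᵥ u) - B *ᵥ (B *ᵥ u))
    rw [e₅] at h₂
    rw [e₁, e₂]
    have h₄ : (r • (P *ᵥ u) - B *ᵥ (B *ᵥ u)) ⬝ᵥ (r • (P *ᵥ u) - B *ᵥ (B *ᵥ u)) =
        r ^ 2 * ((P *ᵥ u) ⬝ᵥ (P *ᵥ u)) - 2 * r * ((B *ᵥ u) ⬝ᵥ (B *ᵥ u)) +
          (B *ᵥ (B *ᵥ u)) ⬝ᵥ (B *ᵥ (B *ᵥ u)) := by
      simp only [sub_dotProduct, dotProduct_sub, smul_dotProduct, dotProduct_smul, smul_eq_mul,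
        e₆, e₇]
      ring
    set Y := (r • (P *ᵥ u) - B *ᵥ (B *ᵥ u)) ⬝ᵥ (r • (P *ᵥ u) - B *ᵥ (B *ᵥ u))
    have h₅ : κ * ((M *ᵥ u) ⬝ᵥ (M *ᵥ u)) ≤ Y := calc
      κ * ((M *ᵥ u) ⬝ᵥ (M *ᵥ u)) ≤ κ * (μ * (K * Y)) := by
        refine mul_le_mul_of_nonneg_left (h₁.trans ?_) hκ0.le
        exact mul_le_mul_of_nonneg_left h₂ hμ0
      _ = κ * (μ * K) * Y := by ring
      _ ≤ 1 * Y := mul_le_mul_of_nonneg_right hκ2 h₃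
      _ = Y := one_mul Y
    nlinarith
  · rw [hC]
    linarith

/-- A product of a continuous function and a differentiable function vanishing at the point is
differentiable there. -/
theorem ContinuousAt.mul_hasFDerivAt_of_eq_zero {Z : Type*} [NormedAddCommGroup Z]
    [NormedSpace ℝ Z] {u v : Z → ℝ} {v' : Z →L[ℝ] ℝ} {z : Z} (hu : ContinuousAt u z)
    (hv : HasFDerivAt v v' z) (h0 : v z = 0) :
    HasFDerivAt (fun w => u w * v w) (u z • v') z := by
  rw [hasFDerivAt_iff_isLittleO]
  have h₁ : (fun w => (u w - u z) * v w) =o[𝓝 z] fun w => w - z := by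
    have hu' : (fun w => u w - u z) =o[𝓝 z] fun _ => (1 : ℝ) := by
      rw [Asymptotics.isLittleO_one_iff]
      simpa using hu.tendsto.sub_const (u z)
    have hv' : v =O[𝓝 z] fun w => w - z := by simpa [h0] using hv.isBigO_sub
    simpa using (hu'.mul_isBigO hv'.norm_right).norm_right
  have h₂ := hv.isLittleO.const_mul_left (u z)
  refine (h₁.add h₂).congr_left fun w => ?_
  simp [h0]
  ring

theorem ContinuousAt.mulVec_hasFDerivAt_of_eq_zero {Z ι : Type*} [NormedAddCommGroup Z]
    [NormedSpace ℝ Z] [Fintype ι] {N : Z → Matrix ι ι ℝ} {v : Z → ι → ℝ}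
    {v' : Z →L[ℝ] (ι → ℝ)} {z : Z} (hN : ContinuousAt N z) (hv : HasFDerivAt v v' z)
    (h0 : v z = 0) :
    HasFDerivAt (fun w => N w *ᵥ v w) ((N z).mulVecLin.toContinuousLinearMap ∘L v') z := by
  rw [hasFDerivAt_pi']
  intro i
  have hNij : ∀ j, ContinuousAt (fun w => N w i j) z := fun j =>
    ((continuous_apply_apply i j).continuousAt (x := N z)).comp hN
  have := HasFDerivAt.fun_sum (u := Finset.univ) fun j _ =>
    (hNij j).mul_hasFDerivAt_of_eq_zero (hasFDerivAt_pi'.mp hv j) (congrFun h0 j)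
  refine this.congr_fderiv (ContinuousLinearMap.ext fun w => ?_)
  simp [mulVec, dotProduct]

theorem ContinuousAt.matrix_inv_of_isUnit {Z ι : Type*} [TopologicalSpace Z] [Fintype ι]
    [DecidableEq ι] {N : Z → Matrix ι ι ℝ} {z : Z} (hN : ContinuousAt N z)
    (hdet : IsUnit (N z).det) : ContinuousAt (fun w => (N w)⁻¹) z := by
  refine ContinuousAt.comp (f := N) (continuousAt_matrix_inv _ ?_) hN
  rw [Ring.inverse_eq_inv']
  exact continuousAt_inv₀ hdet.ne_zero

theorem fderiv_apply_eq_sum_pd (h : EuclideanSpace ℝ (Fin n) → ℝ) (x y : EuclideanSpace ℝ (Fin n)) :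
    fderiv ℝ h x y = ∑ i, pd h x i * y i := by
  have hy : y = ∑ i, y i • EuclideanSpace.single i (1 : ℝ) := by
    ext j
    simp [Finset.sum_apply, Pi.single_apply]
  conv_lhs => rw [hy]
  simp [pd, mul_comm]

theorem gradient_apply_eq_pd (h : EuclideanSpace ℝ (Fin n) → ℝ) (x : EuclideanSpace ℝ (Fin n))
    (i : Fin n) : gradient h x i = pd h x i := by
  rw [pd, ← inner_gradient_left]
  exact (by simpa using (EuclideanSpace.inner_single_right i (1 : ℝ) (gradient h x)).symm)

theorem ContDiff.differentiable_pd {h : EuclideanSpace ℝ (Fin n) → ℝ} (hh : ContDiff ℝ 2 h)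
    (i : Fin n) : Differentiable ℝ fun y => pd h y i := by
  have : ContDiff ℝ 1 (fderiv ℝ h) := hh.fderiv_right (by norm_num)
  exact (this.differentiable (by norm_num)).clm_apply (differentiable_const _)

section InteriorPoint

variable {f : EuclideanSpace ℝ (Fin n) → ℝ} {G : EuclideanSpace ℝ (Fin n) → Fin l → ℝ}
  {F : EuclideanSpace ℝ (Fin n) → Fin m → ℝ}

theorem pd_LagrangianMin (hf : ContDiff ℝ 2 f) (hG : ContDiff ℝ 2 G) (hF : ContDiff ℝ 2 F)
    (z : ZMin n l m) (x : EuclideanSpace ℝ (Fin n)) (i : Fin n) :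
    pd (LagrangianMin f G F z) x i = pd f x i + (∑ j, z.2.2.1 j * pd (fun y => G y j) x i) +
      ∑ k, z.2.2.2 k * pd (fun y => F y k) x i := by
  have hf' := (hf.differentiable (by norm_num) x).hasFDerivAt
  have hG' := fun j => (((contDiff_pi.mp hG j).differentiable (by norm_num)) x).hasFDerivAt
  have hF' := fun k => (((contDiff_pi.mp hF k).differentiable (by norm_num)) x).hasFDerivAt
  have := (hf'.add (HasFDerivAt.fun_sum (u := Finset.univ) fun j _ =>
    (hG' j).const_mul (z.2.2.1 j))).add (HasFDerivAt.fun_sum (u := Finset.univ) fun k _ =>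
    ((hF' k).add_const (z.2.1 k)).const_mul (z.2.2.2 k))
  have hL : fderiv ℝ (LagrangianMin f G F z) x = _ := this.fderiv
  rw [pd, hL]
  simp [pd]

theorem hasFDerivAt_slack (z : ZMin n l m) (i : Fin m) :
    HasFDerivAt (fun w : ZMin n l m => w.2.1 i)
      (ContinuousLinearMap.proj i ∘L ContinuousLinearMap.fst ℝ _ _ ∘L
        ContinuousLinearMap.snd ℝ _ _) z :=
  (ContinuousLinearMap.proj (R := ℝ) (φ := fun _ : Fin m => ℝ) i ∘L ContinuousLinearMap.fst ℝ _ _ ∘L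
    ContinuousLinearMap.snd ℝ _ _ : ZMin n l m →L[ℝ] ℝ).hasFDerivAt

theorem hasFDerivAt_eqMultiplier (z : ZMin n l m) (j : Fin l) :
    HasFDerivAt (fun w : ZMin n l m => w.2.2.1 j)
      (ContinuousLinearMap.proj j ∘L ContinuousLinearMap.fst ℝ _ _ ∘L
        ContinuousLinearMap.snd ℝ _ _ ∘L ContinuousLinearMap.snd ℝ _ _) z :=
  (ContinuousLinearMap.proj (R := ℝ) (φ := fun _ : Fin l => ℝ) j ∘L ContinuousLinearMap.fst ℝ _ _ ∘L ContinuousLinearMap.snd ℝ _ _ ∘L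
    ContinuousLinearMap.snd ℝ _ _ : ZMin n l m →L[ℝ] ℝ).hasFDerivAt

theorem hasFDerivAt_ineqMultiplier (z : ZMin n l m) (i : Fin m) :
    HasFDerivAt (fun w : ZMin n l m => w.2.2.2 i)
      (ContinuousLinearMap.proj i ∘L ContinuousLinearMap.snd ℝ _ _ ∘L
        ContinuousLinearMap.snd ℝ _ _ ∘L ContinuousLinearMap.snd ℝ _ _) z :=
  (ContinuousLinearMap.proj (R := ℝ) (φ := fun _ : Fin m => ℝ) i ∘L ContinuousLinearMap.snd ℝ _ _ ∘L ContinuousLinearMap.snd ℝ _ _ ∘L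
    ContinuousLinearMap.snd ℝ _ _ : ZMin n l m →L[ℝ] ℝ).hasFDerivAt

theorem hasFDerivAt_pd_LagrangianMin (hf : ContDiff ℝ 2 f) (hG : ContDiff ℝ 2 G)
    (hF : ContDiff ℝ 2 F) (z : ZMin n l m) (i : Fin n) :
    ∃ D : ZMin n l m →L[ℝ] ℝ,
      HasFDerivAt (fun w : ZMin n l m => pd (LagrangianMin f G F w) w.1 i) D z ∧
      ∀ d, D d = (∑ j, hessian (LagrangianMin f G F z) z.1 j i * d.1 j) +
        (∑ j, pd (fun y => G y j) z.1 i * d.2.2.1 j) +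
        ∑ k, pd (fun y => F y k) z.1 i * d.2.2.2 k := by
  have hf' := (hf.differentiable_pd i z.1).hasFDerivAt
  have hG' := fun j => ((contDiff_pi.mp hG j).differentiable_pd i z.1).hasFDerivAt
  have hF' := fun k => ((contDiff_pi.mp hF k).differentiable_pd i z.1).hasFDerivAt
  have hhess : fderiv ℝ (fun y => pd (LagrangianMin f G F z) y i) z.1 =
      fderiv ℝ (fun y => pd f y i) z.1 +
      (∑ j, z.2.2.1 j • fderiv ℝ (fun y => pd (fun x => G x j) y i) z.1) +
      ∑ k, z.2.2.2 k • fderiv ℝ (fun y => pd (fun x => F x k) y i) z.1 := by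
    simp only [pd_LagrangianMin hf hG hF]
    exact ((hf'.add (HasFDerivAt.fun_sum (u := Finset.univ) fun j _ =>
      (hG' j).const_mul (z.2.2.1 j))).add (HasFDerivAt.fun_sum (u := Finset.univ) fun k _ =>
      (hF' k).const_mul (z.2.2.2 k))).fderiv
  have hfst : HasFDerivAt (fun w : ZMin n l m => w.1) (ContinuousLinearMap.fst ℝ _ _) z :=
    hasFDerivAt_fst
  have hD := ((hf'.comp z hfst).add (HasFDerivAt.fun_sum (u := Finset.univ) fun j _ =>
    (hasFDerivAt_eqMultiplier z j).mul ((hG' j).comp z hfst))).add (HasFDerivAt.fun_sum (u := Finset.univ) fun k _ =>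
    (hasFDerivAt_ineqMultiplier z k).mul ((hF' k).comp z hfst))
  simp only [pd_LagrangianMin hf hG hF]
  refine ⟨_, hD, fun d => ?_⟩
  have hsum : (∑ j, hessian (LagrangianMin f G F z) z.1 j i * d.1 j) =
      fderiv ℝ (fun y => pd (LagrangianMin f G F z) y i) z.1 d.1 := by
    rw [fderiv_apply_eq_sum_pd]
    rfl
  rw [hsum, hhess]
  simp [Finset.sum_add_distrib]
  ring

/-- The primal-dual variables as vectors indexed by the blocks. -/
def ZMin.flat : ZMin n l m ≃L[ℝ] (ιMin n l m → ℝ) :=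
  LinearEquiv.toContinuousLinearEquiv
    { toFun := fun z => Sum.elim (Sum.elim z.1 z.2.1) (Sum.elim z.2.2.1 z.2.2.2)
      invFun := fun d => ((WithLp.equiv 2 (Fin n → ℝ)).symm fun i => d (Sum.inl (Sum.inl i)),
        fun i => d (Sum.inl (Sum.inr i)), fun j => d (Sum.inr (Sum.inl j)),
        fun i => d (Sum.inr (Sum.inr i)))
      map_add' := fun z w => by
        ext ((i | i) | (i | i)) <;> simp
      map_smul' := fun c z => by
        ext ((i | i) | (i | i)) <;> simp
      left_inv := fun z => rfl
      right_inv := fun d => by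
        ext ((i | i) | (i | i)) <;> rfl }

theorem ZMin.flat_apply (z : ZMin n l m) :
    ZMin.flat z = Sum.elim (Sum.elim z.1 z.2.1) (Sum.elim z.2.2.1 z.2.2.2) := rfl

theorem ipMinMap_eq (ε : ZMin n l m → ℝ) (b : ℝ) (z : ZMin n l m) :
    ipMinMap f G F ε b z = z - ZMin.flat.symm
      (((JzzMin f G F z + EMin ε z)⁻¹ * (SMin z)⁻¹) *ᵥ gMin f G F z b) := by
  rw [← mulVec_mulVec]
  rfl

theorem SMin_mul_mulVec_apply (z : ZMin n l m) (A : Matrix (ιMin n l m) (ιMin n l m) ℝ)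
    (v : ιMin n l m → ℝ) (k : ιMin n l m) :
    ((SMin z * A) *ᵥ v) k =
      Sum.elim (Sum.elim (fun _ => 1) z.2.1) (fun _ => 1) k * (A *ᵥ v) k := by
  rw [← mulVec_mulVec, SMin, mulVec_diagonal]

theorem hasFDerivAt_gMin (hf : ContDiff ℝ 2 f) (hG : ContDiff ℝ 2 G) (hF : ContDiff ℝ 2 F)
    (b : ℝ) (z : ZMin n l m) (hs : ∀ i, z.2.1 i ≠ 0) (hJ : (JzzMin f G F z).IsHermitian) :
    HasFDerivAt (fun w => gMin f G F w b)
      ((SMin z * JzzMin f G F z).mulVecLin.toContinuousLinearMap ∘L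
        (ZMin.flat : ZMin n l m ≃L[ℝ] _).toContinuousLinearMap) z := by
  have hfst : HasFDerivAt (fun w : ZMin n l m => w.1) (ContinuousLinearMap.fst ℝ _ _) z :=
    hasFDerivAt_fst
  have hG' := fun j => (((contDiff_pi.mp hG j).differentiable (by norm_num)) z.1).hasFDerivAt
  have hF' := fun k => (((contDiff_pi.mp hF k).differentiable (by norm_num)) z.1).hasFDerivAt
  rw [hasFDerivAt_pi']
  rintro ((i | i) | (j | i))
  · obtain ⟨D, hD, hDd⟩ := hasFDerivAt_pd_LagrangianMin hf hG hF z i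
    simp only [gMin, Sum.elim_inl, gradient_apply_eq_pd]
    refine hD.congr_fderiv (ContinuousLinearMap.ext fun d => ?_)
    have hsym : ∀ j, hessian (LagrangianMin f G F z) z.1 j i =
        hessian (LagrangianMin f G F z) z.1 i j := fun j =>
      hJ.apply (Sum.inl (Sum.inl i)) (Sum.inl (Sum.inl j))
    rw [hDd]
    simp [SMin_mul_mulVec_apply, ZMin.flat_apply]
    simp [JzzMin, mulVec, dotProduct, hsym, add_assoc]
  · refine (((hasFDerivAt_ineqMultiplier z i).mul (hasFDerivAt_slack z i)).sub_const b).congr_fderiv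
      (ContinuousLinearMap.ext fun d => ?_)
    have := hs i
    simp [SMin_mul_mulVec_apply, ZMin.flat_apply]
    simp [JzzMin, mulVec, dotProduct, diagonal_apply, one_apply]
    field_simp
  · refine ((hG' j).comp z hfst).congr_fderiv (ContinuousLinearMap.ext fun d => ?_)
    simp [SMin_mul_mulVec_apply, ZMin.flat_apply]
    simp [JzzMin, mulVec, dotProduct, fderiv_apply_eq_sum_pd]
  · refine (((hF' i).comp z hfst).add (hasFDerivAt_slack z i)).congr_fderiv
      (ContinuousLinearMap.ext fun d => ?_)
    simp [SMin_mul_mulVec_apply, ZMin.flat_apply]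
    simp [JzzMin, mulVec, dotProduct, one_apply, fderiv_apply_eq_sum_pd]

theorem slack_ne_zero_of_gMin_eq_zero {b : ℝ} (hb : 0 < b) {z : ZMin n l m}
    (h : gMin f G F z b = 0) (i : Fin m) : z.2.1 i ≠ 0 := by
  intro hi
  have := congrFun h (Sum.inl (Sum.inr i))
  simp [gMin, hi] at this
  linarith

theorem isUnit_det_SMin {z : ZMin n l m} (hs : ∀ i, z.2.1 i ≠ 0) : IsUnit (SMin z).det := by
  rw [SMin, det_diagonal, isUnit_iff_ne_zero, Finset.prod_ne_zero_iff]
  rintro ((i | i) | j) - <;> simp [hs]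

theorem continuous_SMin : Continuous (SMin : ZMin n l m → Matrix (ιMin n l m) (ιMin n l m) ℝ) := by
  refine Continuous.matrix_diagonal (continuous_pi ?_)
  rintro ((i | i) | j) <;> simp only [Sum.elim_inl, Sum.elim_inr] <;> fun_prop

theorem hasFDerivAt_ipMinMap (hf : ContDiff ℝ 2 f) (hG : ContDiff ℝ 2 G) (hF : ContDiff ℝ 2 F)
    {b : ℝ} {z : ZMin n l m} {ε : ZMin n l m → ℝ} (hs : ∀ i, z.2.1 i ≠ 0)
    (hJ : (JzzMin f G F z).IsHermitian) (h0 : gMin f G F z b = 0)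
    (hcont : ∀ i j, ContinuousAt (fun w => JzzMin f G F w i j) z)
    (hε : ∀ᶠ w in 𝓝 z, ε w = ε z) (hdet : IsUnit (JzzMin f G F z + EMin ε z).det) :
    HasFDerivAt (ipMinMap f G F ε b)
      ((ZMin.flat : ZMin n l m ≃L[ℝ] _).symm.toContinuousLinearMap ∘L
        ((JzzMin f G F z + EMin ε z)⁻¹ * EMin ε z).mulVecLin.toContinuousLinearMap ∘L
          (ZMin.flat : ZMin n l m ≃L[ℝ] _).toContinuousLinearMap) z := by
  have hSdet := isUnit_det_SMin hs
  have hJc : ContinuousAt (fun w => JzzMin f G F w) z :=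
    continuousAt_pi.mpr fun i => continuousAt_pi.mpr fun j => hcont i j
  have hEc : ContinuousAt (fun w => EMin ε w) z :=
    continuousAt_const.congr (f := fun _ => EMin ε z) <| by
      filter_upwards [hε] with w hw
      simp only [EMin, hw]
  have hN : ContinuousAt (fun w => (JzzMin f G F w + EMin ε w)⁻¹ * (SMin w)⁻¹) z :=
    ((hJc.add hEc).matrix_inv_of_isUnit hdet).mul
      (continuous_SMin.continuousAt.matrix_inv_of_isUnit hSdet)
  have hd := hN.mulVec_hasFDerivAt_of_eq_zero (hasFDerivAt_gMin hf hG hF b z hs hJ) h0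
  have hT := (hasFDerivAt_id z).sub
    ((ZMin.flat : ZMin n l m ≃L[ℝ] _).symm.toContinuousLinearMap.hasFDerivAt.comp z hd)
  refine (hT.congr_fderiv ?_).congr_of_eventuallyEq (.of_forall fun w => ipMinMap_eq ε b w)
  refine ContinuousLinearMap.ext fun d => (ZMin.flat : ZMin n l m ≃L[ℝ] _).injective ?_
  have hmul : (JzzMin f G F z + EMin ε z)⁻¹ * ((SMin z)⁻¹ * (SMin z * JzzMin f G F z)) =
      1 - (JzzMin f G F z + EMin ε z)⁻¹ * EMin ε z := by
    rw [← mul_assoc (SMin z)⁻¹, nonsing_inv_mul _ hSdet, one_mul, eq_sub_iff_add_eq,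
      ← mul_add, nonsing_inv_mul _ hdet]
  simp [mulVec_mulVec, hmul, sub_mulVec]

/-- The coordinate projection onto the `x` block. -/
def xProj : Matrix (ιMin n l m) (ιMin n l m) ℝ :=
  Matrix.diagonal (Sum.elim (Sum.elim (fun _ => 1) (fun _ => 0)) (fun _ => 0))

theorem transpose_xProj : (xProj : Matrix (ιMin n l m) (ιMin n l m) ℝ)ᵀ = xProj :=
  diagonal_transpose _

theorem xProj_mul_self : (xProj : Matrix (ιMin n l m) (ιMin n l m) ℝ) * xProj = xProj := by
  rw [xProj, diagonal_mul_diagonal]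
  congr 1
  ext ((i | i) | j) <;> simp

theorem EMin_eq_smul (ε : ZMin n l m → ℝ) (z : ZMin n l m) : EMin ε z = ε z • xProj := by
  rw [xProj, ← diagonal_smul, EMin]
  congr 1
  ext ((i | i) | j) <;> simp

theorem posSemidef_EMin {ε : ZMin n l m → ℝ} {z : ZMin n l m} (h : 0 ≤ ε z) :
    (EMin ε z).PosSemidef := by
  refine PosSemidef.diagonal fun i => ?_
  rcases i with (i | i) | j <;> simp [h]

theorem ZMin.exists_norm_sq_le_flat_dotProduct :
    ∃ κ : ℝ, 0 < κ ∧ ∀ z : ZMin n l m, κ * ‖z‖ ^ 2 ≤ ZMin.flat z ⬝ᵥ ZMin.flat z := by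
  set N := ‖((ZMin.flat : ZMin n l m ≃L[ℝ] _).symm : (ιMin n l m → ℝ) →L[ℝ] ZMin n l m)‖
  have hN : 0 ≤ N := norm_nonneg _
  refine ⟨1 / (N ^ 2 + 1), by positivity, fun z => ?_⟩
  have h₁ : ‖z‖ ≤ N * ‖ZMin.flat z‖ := by
    simpa using ((ZMin.flat : ZMin n l m ≃L[ℝ] _).symm :
      (ιMin n l m → ℝ) →L[ℝ] ZMin n l m).le_opNorm (ZMin.flat z)
  have h₂ : ‖ZMin.flat z‖ ^ 2 ≤ ZMin.flat z ⬝ᵥ ZMin.flat z := by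
    refine (Real.le_sqrt (norm_nonneg _) (dotProduct_self_nonneg_real _)).mp ?_
    refine (pi_norm_le_iff_of_nonneg (Real.sqrt_nonneg _)).mpr fun i => ?_
    refine Real.abs_le_sqrt ?_
    simp only [dotProduct, ← pow_two]
    exact Finset.single_le_sum (f := fun i => ZMin.flat z i ^ 2) (fun _ _ => sq_nonneg _)
      (Finset.mem_univ i)
  have h₃ : ‖z‖ ^ 2 ≤ N ^ 2 * ‖ZMin.flat z‖ ^ 2 := by
    rw [← mul_pow]
    gcongr
  rw [one_div, inv_mul_le_iff₀ (by positivity)]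
  nlinarith [sq_nonneg N, dotProduct_self_nonneg_real (ZMin.flat z)]

end InteriorPoint

/-- **Theorem (instability part)**: if the second order sufficient conditions fail at an
equilibrium point of the modified primal-dual interior-point method, then it is an unstable
equilibrium. -/
theorem ipMin_unstable_of_not_secondOrder
    (f : EuclideanSpace ℝ (Fin n) → ℝ) (G : EuclideanSpace ℝ (Fin n) → Fin l → ℝ)
    (F : EuclideanSpace ℝ (Fin n) → Fin m → ℝ)
    (hf : ContDiff ℝ 2 f) (hG : ContDiff ℝ 2 G) (hF : ContDiff ℝ 2 F)
    (b : ℝ) (hb : 0 < b) (zs : ZMin n l m)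
    (heq : gMin f G F zs b = 0)
    -- LICQ :
    (hLICQ : LinearIndependent ℝ
      (Sum.elim (fun j : Fin l => gradient (fun x' => G x' j) zs.1)
        (fun i : {i : Fin m // F zs.1 i = 0} => gradient (fun x' => F x' i.1) zs.1)))
    -- strict complementarity :
    (hstrict : ∀ i, F zs.1 i = 0 → 0 < zs.2.2.2 i)
    (hinv : IsUnit (JzzMin f G F zs).det)
    (hJdiff : ∀ᶠ w in 𝓝 zs, ∀ i j, DifferentiableAt ℝ (fun w' => JzzMin f G F w' i j) w)
    (ε : ZMin n l m → ℝ) (hε0 : ∀ z, 0 ≤ ε z)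
    (hεconst : ∀ᶠ w in 𝓝 zs, ε w = ε zs)
    (hεinertia : HasInertia (JzzMin f G F zs + EMin ε zs) (n + m, l + m, 0))
    -- second order sufficient conditions for a local minimum fail :
    (hsecond : ∃ t : ℕ × ℕ × ℕ, t ≠ (n + m, l + m, 0) ∧ HasInertia (JzzMin f G F zs) t) :
    IsUnstableFixedPt (ipMinMap f G F ε b) zs := by
  have hs := slack_ne_zero_of_gMin_eq_zero hb heq
  obtain ⟨t, ht, hJ⟩ := hsecond
  have hJh : (JzzMin f G F zs).IsHermitian := hJ.1
  have hAh : (JzzMin f G F zs + EMin ε zs).IsHermitian := hεinertia.1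
  have hAdet := hεinertia.isUnit_det
  have hfix : ipMinMap f G F ε b zs = zs := by simp [ipMinMap_eq, heq]
  refine ⟨hfix, ?_⟩
  have hdiff := hasFDerivAt_ipMinMap hf hG hF hs hJh heq
    (fun i j => (hJdiff.self_of_nhds i j).continuousAt) hεconst hAdet
  have hJA : JzzMin f G F zs = (JzzMin f G F zs + EMin ε zs) - EMin ε zs := by simp
  obtain ⟨v, hv⟩ := exists_lt_of_hasInertia_sub_ne hεinertia (posSemidef_EMin (hε0 zs))
    (hJA ▸ hJ) (hJA ▸ hinv) ht
  generalize JzzMin f G F zs + EMin ε zs = A at *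
  set P : Matrix (ιMin n l m) (ιMin n l m) ℝ := xProj
  have hPT : Pᵀ = P := transpose_xProj
  have hPP : P * P = P := xProj_mul_self
  have hEP : EMin ε zs = ε zs • P := EMin_eq_smul ε zs
  have hAinv : (A⁻¹)ᵀ = A⁻¹ := by
    rw [transpose_nonsing_inv]
    exact congrArg _ hAh
  rw [hEP] at hv hdiff
  have hPsymm : ∀ u w, u ⬝ᵥ (P *ᵥ w) = (P *ᵥ u) ⬝ᵥ w := fun u w => by
    rw [dotProduct_mulVec, ← mulVec_transpose, hPT]
  have hv' : (P *ᵥ v) ⬝ᵥ (P *ᵥ v) < (P *ᵥ v) ⬝ᵥ ((P * (A⁻¹ * (ε zs • P))) *ᵥ v) := by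
    simp only [smul_mulVec, mulVec_smul, dotProduct_smul, smul_dotProduct, smul_eq_mul,
      ← mulVec_mulVec, mul_smul_comm] at hv ⊢
    have hPPv : v ⬝ᵥ (P *ᵥ v) = (P *ᵥ v) ⬝ᵥ (P *ᵥ v) := by
      rw [← hPsymm, mulVec_mulVec, hPP]
    have hPA : (P *ᵥ v) ⬝ᵥ (P *ᵥ (A⁻¹ *ᵥ (P *ᵥ v))) = (P *ᵥ v) ⬝ᵥ (A⁻¹ *ᵥ (P *ᵥ v)) := by
      rw [hPsymm, mulVec_mulVec _ P P, hPP]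
    rw [hPPv] at hv
    rw [hPA]
    exact lt_of_mul_lt_mul_left hv (hε0 zs)
  obtain ⟨C, r, c, hr, hc, hC, u, hu⟩ := exists_expanded_quadraticForm (M := A⁻¹ * (ε zs • P)) hPT
    (by rw [mul_assoc, smul_mul_assoc, hPP])
    (by simp only [transpose_mul, transpose_smul, hAinv, hPT, mul_smul_comm, mul_assoc]) hv'
  obtain ⟨κ, hκ, hκz⟩ := ZMin.exists_norm_sq_le_flat_dotProduct (n := n) (l := l) (m := m)
  let e : ZMin n l m →ₗ[ℝ] (ιMin n l m → ℝ) := ZMin.flat.toLinearEquiv.toLinearMap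
  have hB : ∀ z w, ((toLinearMap₂' ℝ C).compl₁₂ e e).toContinuousBilinearMap z w =
      ZMin.flat z ⬝ᵥ (C *ᵥ ZMin.flat w) := fun z w => by
    rw [LinearMap.toContinuousBilinearMap_apply, LinearMap.compl₁₂_apply, toLinearMap₂'_apply']
    rfl
  refine not_stableFixedPt_of_quadratic hdiff hfix
    ((toLinearMap₂' ℝ C).compl₁₂ e e).toContinuousBilinearMap hr (mul_pos hc hκ) (fun x => ?_)
    ⟨ZMin.flat.symm u, ?_⟩
  · rw [hB, hB]
    refine le_trans ?_ ((hC (ZMin.flat x)).trans (le_of_eq ?_))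
    · rw [mul_assoc]
      exact mul_le_mul_of_nonneg_left (hκz x) hc.le
    · generalize A⁻¹ * (ε zs • P) = M
      simp
  · rw [hB]
    simpa using hu
end
end

section
/- Let f : ℝ^{n_x} × ℝ^{n_y} → ℝ be twice continuously differentiable, let (x*, y*) satisfy ∇ₓf(x*, y*) = 0 and ∇ᵧf(x*, y*) = 0, assume ∇_{zz}f(x*, y*) and ∇_{yy}f(x*, y*) are invertible and ∇_{zz}f(·) is differentiable in a neighborhood of (x*, y*). If (x*, y*) is a local minmax of min_x max_y f, then there exist functions ε_x, ε_y : ℝ^{n_x}×ℝ^{n_y} → [0, ∞), constant in a neighborhood of (x*, y*) and satisfying the LQAC at (x*, y*), such that (x*, y*) is a locally asymptotically stable equilibrium of the modified Newton iteration (x, y)⁺ = (x, y) − (∇_{zz}f(x, y) + E(x, y))⁻¹ (∇ₓf(x, y); ∇ᵧf(x, y)), where E(x, y) = diag(ε_x(x, y)·1_{n_x}, −ε_y(x, y)·1_{n_y}). -/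
open Filter Topology Matrix

noncomputable section

variable {nx ny : ℕ}

/-- Partial derivative of `f(x,y)` in the `i`-th `x`-coordinate. -/
def pdX (f : EuclideanSpace ℝ (Fin nx) → EuclideanSpace ℝ (Fin ny) → ℝ)
    (x : EuclideanSpace ℝ (Fin nx)) (y : EuclideanSpace ℝ (Fin ny)) (i : Fin nx) : ℝ :=
  fderiv ℝ (fun x' => f x' y) x (EuclideanSpace.single i 1)

/-- Partial derivative of `f(x,y)` in the `j`-th `y`-coordinate. -/
def pdY (f : EuclideanSpace ℝ (Fin nx) → EuclideanSpace ℝ (Fin ny) → ℝ)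
    (x : EuclideanSpace ℝ (Fin nx)) (y : EuclideanSpace ℝ (Fin ny)) (j : Fin ny) : ℝ :=
  fderiv ℝ (fun y' => f x y') y (EuclideanSpace.single j 1)

/-- The block `∇ₓₓf(x,y)`. -/
def Hxx (f : EuclideanSpace ℝ (Fin nx) → EuclideanSpace ℝ (Fin ny) → ℝ)
    (x : EuclideanSpace ℝ (Fin nx)) (y : EuclideanSpace ℝ (Fin ny)) :
    Matrix (Fin nx) (Fin nx) ℝ :=
  Matrix.of fun i j => fderiv ℝ (fun x' => pdX f x' y j) x (EuclideanSpace.single i 1)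

/-- The block `∇ₓᵧf(x,y)`. -/
def Hxy (f : EuclideanSpace ℝ (Fin nx) → EuclideanSpace ℝ (Fin ny) → ℝ)
    (x : EuclideanSpace ℝ (Fin nx)) (y : EuclideanSpace ℝ (Fin ny)) :
    Matrix (Fin nx) (Fin ny) ℝ :=
  Matrix.of fun i j => fderiv ℝ (fun x' => pdY f x' y j) x (EuclideanSpace.single i 1)

/-- The block `∇ᵧₓf(x,y)`. -/
def Hyx (f : EuclideanSpace ℝ (Fin nx) → EuclideanSpace ℝ (Fin ny) → ℝ)
    (x : EuclideanSpace ℝ (Fin nx)) (y : EuclideanSpace ℝ (Fin ny)) :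
    Matrix (Fin ny) (Fin nx) ℝ :=
  Matrix.of fun j i => fderiv ℝ (fun y' => pdX f x y' i) y (EuclideanSpace.single j 1)

/-- The block `∇ᵧᵧf(x,y)`. -/
def Hyy (f : EuclideanSpace ℝ (Fin nx) → EuclideanSpace ℝ (Fin ny) → ℝ)
    (x : EuclideanSpace ℝ (Fin nx)) (y : EuclideanSpace ℝ (Fin ny)) :
    Matrix (Fin ny) (Fin ny) ℝ :=
  Matrix.of fun i j => fderiv ℝ (fun y' => pdY f x y' j) y (EuclideanSpace.single i 1)

/-- The full Hessian `∇_zz f(x,y) = [[∇ₓₓf, ∇ₓᵧf],[∇ᵧₓf, ∇ᵧᵧf]]`. -/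
def Hzz (f : EuclideanSpace ℝ (Fin nx) → EuclideanSpace ℝ (Fin ny) → ℝ)
    (x : EuclideanSpace ℝ (Fin nx)) (y : EuclideanSpace ℝ (Fin ny)) :
    Matrix (Fin nx ⊕ Fin ny) (Fin nx ⊕ Fin ny) ℝ :=
  Matrix.fromBlocks (Hxx f x y) (Hxy f x y) (Hyx f x y) (Hyy f x y)

/-- `(xs, ys)` is a local minmax point of `min_x max_y f(x,y)`. -/
def IsLocalMinMax (f : EuclideanSpace ℝ (Fin nx) → EuclideanSpace ℝ (Fin ny) → ℝ)
    (xs : EuclideanSpace ℝ (Fin nx)) (ys : EuclideanSpace ℝ (Fin ny)) : Prop :=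
  ∃ δ₀ > (0 : ℝ), ∃ h : ℝ → ℝ,
    (∀ δ ∈ Set.Ioc (0 : ℝ) δ₀, 0 < h δ) ∧
    Tendsto h (𝓝[>] 0) (𝓝 0) ∧
    ∀ δ ∈ Set.Ioc (0 : ℝ) δ₀, ∀ x y, ‖x - xs‖ ≤ δ → ‖y - ys‖ ≤ h δ →
      f xs y ≤ f xs ys ∧ ∃ yt, ‖yt - ys‖ ≤ h δ ∧ f xs ys ≤ f x yt

/-- Local asymptotic stability: fixed point, stability, and local attractivity. -/
def IsLASFixedPt {Z : Type*} [NormedAddCommGroup Z] (T : Z → Z) (z : Z) : Prop :=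
  Function.IsFixedPt T z ∧ StableFixedPt T z ∧
    ∃ δ > 0, ∀ z₀, ‖z₀ - z‖ < δ → Tendsto (fun k => T^[k] z₀) atTop (𝓝 z)

/-- The modification matrix `E(x,y) = diag(ε_x·1_{n_x}, −ε_y·1_{n_y})`. -/
def Emod (nx ny : ℕ) (εx εy : ℝ) : Matrix (Fin nx ⊕ Fin ny) (Fin nx ⊕ Fin ny) ℝ :=
  Matrix.diagonal (Sum.elim (fun _ => εx) (fun _ => -εy))

/-- The Local Quadratic Approximation Condition (LQAC) at `(x,y)`. -/
def LQAC (f : EuclideanSpace ℝ (Fin nx) → EuclideanSpace ℝ (Fin ny) → ℝ)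
    (εx εy : EuclideanSpace ℝ (Fin nx) × EuclideanSpace ℝ (Fin ny) → ℝ)
    (p : EuclideanSpace ℝ (Fin nx) × EuclideanSpace ℝ (Fin ny)) : Prop :=
  HasInertia (Hyy f p.1 p.2 - εy p • (1 : Matrix (Fin ny) (Fin ny) ℝ)) (0, ny, 0) ∧
  HasInertia (Hzz f p.1 p.2 + Emod nx ny (εx p) (εy p)) (nx, ny, 0)

/-- The modified Newton iteration for minmax:
`(x,y)⁺ = (x,y) − (∇_zz f + E)⁻¹ (∇ₓf; ∇ᵧf)`. -/
def newtonMinMaxMap (f : EuclideanSpace ℝ (Fin nx) → EuclideanSpace ℝ (Fin ny) → ℝ)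
    (εx εy : EuclideanSpace ℝ (Fin nx) × EuclideanSpace ℝ (Fin ny) → ℝ)
    (p : EuclideanSpace ℝ (Fin nx) × EuclideanSpace ℝ (Fin ny)) :
    EuclideanSpace ℝ (Fin nx) × EuclideanSpace ℝ (Fin ny) :=
  let d : Fin nx ⊕ Fin ny → ℝ :=
    (Hzz f p.1 p.2 + Emod nx ny (εx p) (εy p))⁻¹.mulVec
      (Sum.elim (fun i => pdX f p.1 p.2 i) (fun j => pdY f p.1 p.2 j))
  ((WithLp.equiv 2 (Fin nx → ℝ)).symm fun i => p.1 i - d (Sum.inl i),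
    (WithLp.equiv 2 (Fin ny → ℝ)).symm fun j => p.2 j - d (Sum.inr j))

/-- In an eigenbasis, the quadratic form of a symmetric matrix is a weighted sum of squares. -/
theorem dotProduct_mulVec_eq_sum_eigenvalues {ι : Type*} [Fintype ι] [DecidableEq ι]
    {A : Matrix ι ι ℝ} (hA : A.IsHermitian) (v : ι → ℝ) :
    v ⬝ᵥ A *ᵥ v = ∑ i, hA.eigenvalues i *
      ((star (hA.eigenvectorUnitary : Matrix ι ι ℝ) *ᵥ v) i) ^ 2 := by
  have h := hA.spectral_theorem
  rw [Unitary.conjStarAlgAut_apply] at h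
  set U : Matrix ι ι ℝ := (hA.eigenvectorUnitary : Matrix ι ι ℝ)
  conv_lhs => rw [h]
  rw [← mulVec_mulVec, ← mulVec_mulVec, dotProduct_mulVec, ← mulVec_transpose]
  have : Uᵀ = star U := by simp [star_eq_conjTranspose]
  rw [this, dotProduct]
  refine Finset.sum_congr rfl fun i _ => ?_
  rw [mulVec_diagonal]
  simp
  ring

/-- A subspace on which `σ` times the quadratic form of `A` is positive has dimension at most
the number of eigenvalues of `A` with the sign of `σ`. -/
theorem le_card_eigenvalues_of_definite {ι : Type*} [Fintype ι] [DecidableEq ι]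
    {A : Matrix ι ι ℝ} (hA : A.IsHermitian) (σ : ℝ) {k : ℕ} (P : (Fin k → ℝ) →ₗ[ℝ] (ι → ℝ))
    (hP : ∀ u, u ≠ 0 → 0 < σ * (P u ⬝ᵥ A *ᵥ P u)) :
    k ≤ Nat.card {i // 0 < σ * hA.eigenvalues i} := by
  classical
  let C : (Fin k → ℝ) →ₗ[ℝ] ({i // 0 < σ * hA.eigenvalues i} → ℝ) :=
    LinearMap.funLeft ℝ ℝ Subtype.val ∘ₗ
      (star (hA.eigenvectorUnitary : Matrix ι ι ℝ)).mulVecLin ∘ₗ P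
  have hC : Function.Injective C := by
    rw [injective_iff_map_eq_zero]
    intro u hu
    by_contra hne
    refine (hP u hne).not_ge ?_
    rw [dotProduct_mulVec_eq_sum_eigenvalues hA, Finset.mul_sum]
    refine Finset.sum_nonpos fun i _ => ?_
    rw [← mul_assoc]
    by_cases hi : 0 < σ * hA.eigenvalues i
    · have : (star (hA.eigenvectorUnitary : Matrix ι ι ℝ) *ᵥ P u) i = 0 := congrFun hu ⟨i, hi⟩
      simp [this]
    · exact mul_nonpos_of_nonpos_of_nonneg (not_lt.1 hi) (sq_nonneg _)
  simpa [Nat.card_eq_fintype_card] using LinearMap.finrank_le_finrank_of_injective hC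

/-- A continuous bilinear form that is negative definite on a
finite-dimensional space is uniformly negative definite. -/
theorem exists_forall_apply_self_le_neg {G : Type*} [NormedAddCommGroup G] [NormedSpace ℝ G]
    [FiniteDimensional ℝ G] (B : G →L[ℝ] G →L[ℝ] ℝ) (hB : ∀ g, g ≠ 0 → B g g < 0) :
    ∃ c > 0, ∀ g, B g g ≤ -c * ‖g‖ ^ 2 := by
  rcases subsingleton_or_nontrivial G with hG | hG
  · exact ⟨1, one_pos, fun g => by simp [Subsingleton.elim g 0]⟩
  have hcont : Continuous fun g => B g g := by fun_prop
  obtain ⟨g₀, hg₀, hmax⟩ := (isCompact_sphere (0 : G) 1).exists_isMaxOn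
    (NormedSpace.sphere_nonempty.2 zero_le_one) hcont.continuousOn
  have hne : g₀ ≠ 0 := by
    rintro rfl
    simp at hg₀
  refine ⟨-B g₀ g₀, neg_pos.2 (hB g₀ hne), fun g => ?_⟩
  rcases eq_or_ne g 0 with rfl | hg
  · simp
  have hn : ‖g‖ ≠ 0 := norm_ne_zero_iff.2 hg
  have h := hmax (show ‖g‖⁻¹ • g ∈ Metric.sphere (0 : G) 1 by simp [norm_smul, hn])
  simp only [Set.mem_ofPred_eq, map_smul, _root_.smul_apply, smul_eq_mul] at h
  calc B g g = (‖g‖⁻¹ * (‖g‖⁻¹ * B g g)) * ‖g‖ ^ 2 := by field_simp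
    _ ≤ B g₀ g₀ * ‖g‖ ^ 2 := by gcongr
    _ = _ := by ring

/-- Second-order Taylor expansion at a critical point. -/
theorem isLittleO_sub_half_fderiv_fderiv {E : Type*} [NormedAddCommGroup E] [NormedSpace ℝ E]
    {F : E → ℝ} (hF : ContDiff ℝ 2 F) {z : E} (hz : fderiv ℝ F z = 0) :
    (fun h => F (z + h) - F z - fderiv ℝ (fderiv ℝ F) z h h / 2) =o[𝓝 0]
      fun h => ‖h‖ ^ 2 := by
  set D := fderiv ℝ (fderiv ℝ F) z
  have hsymm : IsSymmSndFDerivAt ℝ F z := hF.contDiffAt.isSymmSndFDerivAt (by simp)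
  have hD : HasFDerivAt (fderiv ℝ F) D z :=
    ((hF.fderiv_right (m := 1) (by norm_num)).differentiable one_ne_zero z).hasFDerivAt
  have hder : ∀ h, HasFDerivAt (fun h => F (z + h) - F z - D h h / 2)
      (fderiv ℝ F (z + h) - D h) h := by
    intro h
    have h1 : HasFDerivAt (fun h => F (z + h)) (fderiv ℝ F (z + h)) h := by
      exact (hasFDerivAt_comp_add_left z).2 (hF.differentiable two_ne_zero (z + h)).hasFDerivAt
    have h2 : HasFDerivAt (fun h => D h h) ((D h).comp (.id ℝ E) + D.flip h) h := by
      simpa using D.hasFDerivAt.clm_apply (hasFDerivAt_id h)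
    have h3 := (h1.sub_const (F z)).sub (h2.const_mul (1 / 2))
    refine (h3.congr_fderiv ?_).congr_of_eventuallyEq (.of_forall fun k => ?_)
    · ext v
      have : D h v = D v h := hsymm h v
      simp [← this]
      ring
    · simp
      ring
  rw [hasFDerivAt_iff_isLittleO_nhds_zero] at hD
  rw [Asymptotics.isLittleO_iff]
  intro c hc
  have hev := (Asymptotics.isLittleO_iff.1 hD) hc
  obtain ⟨r, hr, hball⟩ := Metric.eventually_nhds_iff_ball.1 hev
  filter_upwards [Metric.ball_mem_nhds 0 hr] with h hh
  have hh' : ‖h‖ < r := by simpa using hh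
  have := (convex_closedBall (0 : E) ‖h‖).norm_image_sub_le_of_norm_hasFDerivWithin_le
    (f := fun h => F (z + h) - F z - D h h / 2) (C := c * ‖h‖) (x := 0) (y := h)
    (fun k _ => (hder k).hasFDerivWithinAt) (fun k hk => by
      have hk' : ‖k‖ ≤ ‖h‖ := by simpa using hk
      have := hball k (by simpa using hk'.trans_lt hh')
      rw [hz, sub_zero] at this
      exact this.trans (by gcongr)) (by simp) (by simp)
  simp only [map_zero, add_zero, sub_self, zero_div, sub_zero] at this
  simpa [pow_two, mul_assoc] using this

/-- A function whose second derivative at a critical point is negative definite along the range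
of a linear map has a strict local maximum there along that range. -/
theorem eventually_lt_of_fderiv_fderiv_neg {E G : Type*} [NormedAddCommGroup E]
    [NormedSpace ℝ E] [NormedAddCommGroup G] [NormedSpace ℝ G] [FiniteDimensional ℝ G]
    {F : E → ℝ} (hF : ContDiff ℝ 2 F) {z : E} (hz : fderiv ℝ F z = 0) (P : G →L[ℝ] E)
    (hP : ∀ g, g ≠ 0 → fderiv ℝ (fderiv ℝ F) z (P g) (P g) < 0) :
    ∀ᶠ g in 𝓝 (0 : G), g ≠ 0 → F (z + P g) < F z := by
  obtain ⟨c, hc, hcB⟩ := exists_forall_apply_self_le_neg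
    (((fderiv ℝ (fderiv ℝ F) z).bilinearComp P P)) (by simpa using hP)
  have hlim : Tendsto P (𝓝 0) (𝓝 0) := by simpa using P.continuous.tendsto 0
  have hO : (fun g => ‖P g‖ ^ 2) =O[𝓝 0] fun g => ‖g‖ ^ 2 :=
    ((P.isBigO_id (𝓝 0)).norm_norm).pow 2
  have ho := ((isLittleO_sub_half_fderiv_fderiv hF hz).comp_tendsto hlim).trans_isBigO hO
  filter_upwards [Asymptotics.isLittleO_iff.1 ho (show 0 < c / 4 by positivity)] with g hg hne
  have h1 := hcB g
  have h2 : 0 < ‖g‖ := norm_pos_iff.2 hne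
  simp only [Function.comp_apply, Real.norm_eq_abs, ContinuousLinearMap.bilinearComp_apply,
    abs_of_nonneg (sq_nonneg ‖g‖)] at hg h1
  have h3 := (abs_le.1 hg).2
  nlinarith [mul_pos hc (pow_pos h2 2)]

/-- First-order expansion with the derivative taken at the moving point. -/
theorem isLittleO_sub_fderiv_sub {E W : Type*} [NormedAddCommGroup E] [NormedSpace ℝ E]
    [NormedAddCommGroup W] [NormedSpace ℝ W] {G : E → W} (hG : ContDiff ℝ 1 G) (z : E) :
    (fun p => G p - G z - fderiv ℝ G p (p - z)) =o[𝓝 z] fun p => p - z := by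
  have h1 := (hG.differentiable one_ne_zero z).hasFDerivAt.isLittleO
  have h3 : (fun p => ‖fderiv ℝ G z - fderiv ℝ G p‖) =o[𝓝 z] fun _ => (1 : ℝ) := by
    rw [Asymptotics.isLittleO_one_iff]
    simpa using (((hG.continuous_fderiv one_ne_zero).tendsto z).const_sub (fderiv ℝ G z)).norm
  have h2 : (fun p => (fderiv ℝ G z - fderiv ℝ G p) (p - z)) =o[𝓝 z] fun p => p - z := by
    have h4 := h3.mul_isBigO (Asymptotics.isBigO_refl (fun p => ‖p - z‖) (𝓝 z))
    simp only [one_mul] at h4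
    refine (Asymptotics.IsBigO.of_bound 1 (.of_forall fun p => ?_)).trans_isLittleO h4.of_norm_right
    simpa only [one_mul, norm_mul, norm_norm] using
      (fderiv ℝ G z - fderiv ℝ G p).le_opNorm (p - z)
  refine (h1.add h2).congr_left fun p => ?_
  rw [_root_.sub_apply]
  abel

/-- A map that approximates its fixed point to first order is locally asymptotically stable. -/
theorem isLASFixedPt_of_isLittleO {Z : Type*} [NormedAddCommGroup Z] {T : Z → Z} {z : Z}
    (hfix : Function.IsFixedPt T z) (hT : (fun p => T p - z) =o[𝓝 z] fun p => p - z) :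
    IsLASFixedPt T z := by
  have hhalf := Asymptotics.isLittleO_iff.1 hT (show (0 : ℝ) < 1 / 2 by norm_num)
  obtain ⟨r, hr, hball⟩ := Metric.eventually_nhds_iff_ball.1 hhalf
  have key : ∀ p, ‖p - z‖ < r → ∀ k : ℕ, ‖T^[k] p - z‖ ≤ (1 / 2) ^ k * ‖p - z‖ := by
    intro p hp k
    induction k with
    | zero => simp
    | succ k ih =>
      have hlt : ‖T^[k] p - z‖ < r :=
        (ih.trans (mul_le_of_le_one_left (norm_nonneg _)
          (pow_le_one₀ (by norm_num) (by norm_num)))).trans_lt hp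
      rw [Function.iterate_succ_apply']
      calc _ ≤ 1 / 2 * ‖T^[k] p - z‖ := hball _ (by simpa [dist_eq_norm] using hlt)
        _ ≤ 1 / 2 * ((1 / 2) ^ k * ‖p - z‖) := by gcongr
        _ = _ := by ring
  refine ⟨hfix, fun η hη => ⟨min r η, lt_min hr hη, fun p hp k => ?_⟩, r, hr, fun p hp => ?_⟩
  · exact ((key p (hp.trans_le (min_le_left _ _)) k).trans (mul_le_of_le_one_left (norm_nonneg _)
      (pow_le_one₀ (by norm_num) (by norm_num)))).trans_lt (hp.trans_le (min_le_right _ _))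
  · rw [tendsto_iff_norm_sub_tendsto_zero]
    refine squeeze_zero (fun _ => norm_nonneg _) (key p hp) ?_
    simpa using (tendsto_pow_atTop_nhds_zero_of_lt_one (r := (1 / 2 : ℝ)) (by norm_num)
      (by norm_num)).mul_const ‖p - z‖

theorem fderiv_partial_fst {E₁ E₂ W : Type*} [NormedAddCommGroup E₁] [NormedSpace ℝ E₁]
    [NormedAddCommGroup E₂] [NormedSpace ℝ E₂] [NormedAddCommGroup W] [NormedSpace ℝ W]
    {F : E₁ × E₂ → W} {x : E₁} {y : E₂} (hF : DifferentiableAt ℝ F (x, y)) (v : E₁) :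
    fderiv ℝ (fun x' => F (x', y)) x v = fderiv ℝ F (x, y) (v, 0) := by
  have h : HasFDerivAt (fun x' => F (x', y)) _ x :=
    hF.hasFDerivAt.comp x (hasFDerivAt_prodMk_left x y)
  simp [h.fderiv]

theorem fderiv_partial_snd {E₁ E₂ W : Type*} [NormedAddCommGroup E₁] [NormedSpace ℝ E₁]
    [NormedAddCommGroup E₂] [NormedSpace ℝ E₂] [NormedAddCommGroup W] [NormedSpace ℝ W]
    {F : E₁ × E₂ → W} {x : E₁} {y : E₂} (hF : DifferentiableAt ℝ F (x, y)) (v : E₂) :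
    fderiv ℝ (fun y' => F (x, y')) y v = fderiv ℝ F (x, y) (0, v) := by
  have h : HasFDerivAt (fun y' => F (x, y')) _ y :=
    hF.hasFDerivAt.comp y (hasFDerivAt_prodMk_right x y)
  simp [h.fderiv]

/-- Stacked coordinates, as a point of the product of Euclidean spaces. -/
def sumCoordEquiv (nx ny : ℕ) :
    (Fin nx ⊕ Fin ny → ℝ) ≃L[ℝ] EuclideanSpace ℝ (Fin nx) × EuclideanSpace ℝ (Fin ny) :=
  ((LinearEquiv.sumArrowLequivProdArrow (Fin nx) (Fin ny) ℝ ℝ).trans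
    ((WithLp.linearEquiv 2 ℝ (Fin nx → ℝ)).symm.prodCongr
      (WithLp.linearEquiv 2 ℝ (Fin ny → ℝ)).symm)).toContinuousLinearEquiv

theorem sumCoordEquiv_apply (v : Fin nx ⊕ Fin ny → ℝ) :
    sumCoordEquiv nx ny v =
      (WithLp.toLp 2 fun i => v (Sum.inl i), WithLp.toLp 2 fun j => v (Sum.inr j)) :=
  rfl

theorem sumCoordEquiv_single_inl (i : Fin nx) :
    sumCoordEquiv nx ny (Pi.single (Sum.inl i) 1) = (EuclideanSpace.single i 1, 0) := by
  rw [sumCoordEquiv_apply]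
  ext k <;> simp [Pi.single_apply]

theorem sumCoordEquiv_single_inr (j : Fin ny) :
    sumCoordEquiv nx ny (Pi.single (Sum.inr j) 1) = (0, EuclideanSpace.single j 1) := by
  rw [sumCoordEquiv_apply]
  ext k <;> simp [Pi.single_apply]

/-- The stacked gradient `(∇ₓf; ∇ᵧf)`. -/
def stackedGradient (f : EuclideanSpace ℝ (Fin nx) → EuclideanSpace ℝ (Fin ny) → ℝ)
    (p : EuclideanSpace ℝ (Fin nx) × EuclideanSpace ℝ (Fin ny)) : Fin nx ⊕ Fin ny → ℝ :=
  Sum.elim (fun i => pdX f p.1 p.2 i) (fun j => pdY f p.1 p.2 j)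

theorem stackedGradient_apply
    {f : EuclideanSpace ℝ (Fin nx) → EuclideanSpace ℝ (Fin ny) → ℝ}
    (hf : ContDiff ℝ 2 (fun p : EuclideanSpace ℝ (Fin nx) × EuclideanSpace ℝ (Fin ny) =>
      f p.1 p.2))
    (p : EuclideanSpace ℝ (Fin nx) × EuclideanSpace ℝ (Fin ny)) (a : Fin nx ⊕ Fin ny) :
    stackedGradient f p a =
      fderiv ℝ (fun p => f p.1 p.2) p (sumCoordEquiv nx ny (Pi.single a 1)) := by
  have hd := hf.differentiable two_ne_zero p
  rcases a with i | j
  · rw [sumCoordEquiv_single_inl]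
    exact fderiv_partial_fst (F := fun p => f p.1 p.2) hd _
  · rw [sumCoordEquiv_single_inr]
    exact fderiv_partial_snd (F := fun p => f p.1 p.2) hd _

theorem Hzz_apply
    {f : EuclideanSpace ℝ (Fin nx) → EuclideanSpace ℝ (Fin ny) → ℝ}
    (hf : ContDiff ℝ 2 (fun p : EuclideanSpace ℝ (Fin nx) × EuclideanSpace ℝ (Fin ny) =>
      f p.1 p.2))
    (p : EuclideanSpace ℝ (Fin nx) × EuclideanSpace ℝ (Fin ny)) (a b : Fin nx ⊕ Fin ny) :
    Hzz f p.1 p.2 a b = fderiv ℝ (fderiv ℝ (fun p => f p.1 p.2)) p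
      (sumCoordEquiv nx ny (Pi.single a 1)) (sumCoordEquiv nx ny (Pi.single b 1)) := by
  have hd : DifferentiableAt ℝ (fderiv ℝ (fun p => f p.1 p.2)) p :=
    (hf.fderiv_right (m := 1) (by norm_num)).differentiable one_ne_zero p
  have hg : ∀ b, DifferentiableAt ℝ (fun q => stackedGradient f q b) p ∧
      ∀ v, fderiv ℝ (fun q => stackedGradient f q b) p v =
        fderiv ℝ (fderiv ℝ (fun p => f p.1 p.2)) p v (sumCoordEquiv nx ny (Pi.single b 1)) := by
    intro b
    simp only [stackedGradient_apply hf]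
    have := hd.hasFDerivAt.clm_apply
      (hasFDerivAt_const (sumCoordEquiv nx ny (Pi.single b 1)) p)
    exact ⟨this.differentiableAt, fun v => by rw [this.fderiv]; simp⟩
  obtain ⟨hgd, hgv⟩ := hg b
  rw [← hgv]
  rcases a with i | i
  · rw [sumCoordEquiv_single_inl, ← fderiv_partial_fst hgd]
    rcases b with j | j <;> rfl
  · rw [sumCoordEquiv_single_inr, ← fderiv_partial_snd hgd]
    rcases b with j | j <;> rfl

theorem dotProduct_Hzz_mulVec
    {f : EuclideanSpace ℝ (Fin nx) → EuclideanSpace ℝ (Fin ny) → ℝ}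
    (hf : ContDiff ℝ 2 (fun p : EuclideanSpace ℝ (Fin nx) × EuclideanSpace ℝ (Fin ny) =>
      f p.1 p.2))
    (p : EuclideanSpace ℝ (Fin nx) × EuclideanSpace ℝ (Fin ny)) (v w : Fin nx ⊕ Fin ny → ℝ) :
    v ⬝ᵥ Hzz f p.1 p.2 *ᵥ w = fderiv ℝ (fderiv ℝ (fun p => f p.1 p.2)) p
      (sumCoordEquiv nx ny v) (sumCoordEquiv nx ny w) := by
  have hv : ∀ v, sumCoordEquiv nx ny v = ∑ a, v a • sumCoordEquiv nx ny (Pi.single a 1) := by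
    intro v
    conv_lhs => rw [← Finset.univ_sum_single v]
    rw [map_sum]
    refine Finset.sum_congr rfl fun a _ => ?_
    rw [← map_smul, ← Pi.single_smul, smul_eq_mul, mul_one]
  rw [hv v, hv w]
  simp only [map_sum, map_smul, _root_.sum_apply, _root_.smul_apply, smul_eq_mul,
    dotProduct, mulVec, Hzz_apply hf]
  simp only [Finset.mul_sum]
  conv_rhs => rw [Finset.sum_comm]
  refine Finset.sum_congr rfl fun a _ => Finset.sum_congr rfl fun b _ => ?_
  ring

theorem Hzz_isHermitian
    {f : EuclideanSpace ℝ (Fin nx) → EuclideanSpace ℝ (Fin ny) → ℝ}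
    (hf : ContDiff ℝ 2 (fun p : EuclideanSpace ℝ (Fin nx) × EuclideanSpace ℝ (Fin ny) =>
      f p.1 p.2))
    (p : EuclideanSpace ℝ (Fin nx) × EuclideanSpace ℝ (Fin ny)) :
    (Hzz f p.1 p.2).IsHermitian := by
  refine IsHermitian.ext fun a b => ?_
  rw [Hzz_apply hf, Hzz_apply hf, star_trivial]
  exact (hf.contDiffAt.isSymmSndFDerivAt (by simp)) _ _

/-- Matrices with definite subspaces of complementary dimensions have the expected inertia. -/
theorem hasInertia_of_definite {ι : Type*} [Fintype ι] [DecidableEq ι] {A : Matrix ι ι ℝ}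
    (hA : A.IsHermitian) {p q : ℕ} (hcard : Fintype.card ι = p + q)
    (P : (Fin p → ℝ) →ₗ[ℝ] (ι → ℝ)) (hP : ∀ u, u ≠ 0 → 0 < P u ⬝ᵥ A *ᵥ P u)
    (Q : (Fin q → ℝ) →ₗ[ℝ] (ι → ℝ)) (hQ : ∀ u, u ≠ 0 → Q u ⬝ᵥ A *ᵥ Q u < 0) :
    HasInertia A (p, q, 0) := by
  classical
  have hp := le_card_eigenvalues_of_definite hA 1 P (by simpa using hP)
  have hq := le_card_eigenvalues_of_definite hA (-1) Q (by simpa using hQ)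
  simp only [one_mul, neg_mul, Left.neg_pos_iff, Nat.card_eq_fintype_card,
    Fintype.card_subtype] at hp hq
  have hsum : (Finset.univ.filter fun i => 0 < hA.eigenvalues i).card +
      (Finset.univ.filter fun i => hA.eigenvalues i < 0).card +
      (Finset.univ.filter fun i => hA.eigenvalues i = 0).card = p + q := by
    rw [← hcard, ← Finset.card_univ, Finset.card_filter, Finset.card_filter,
      Finset.card_filter, ← Finset.sum_add_distrib, ← Finset.sum_add_distrib, Finset.card_eq_sum_ones]
    refine Finset.sum_congr rfl fun i _ => ?_
    rcases lt_trichotomy (hA.eigenvalues i) 0 with h | h | h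
    · simp [h, h.ne, h.not_gt]
    · simp [h]
    · simp [h, h.ne', h.not_gt]
  refine ⟨hA, ?_⟩
  simp only [Nat.card_eq_fintype_card, Fintype.card_subtype]
  omega

/-- A positive definite Schur complement over a negative definite block fixes the inertia. -/
theorem hasInertia_fromBlocks_of_schur {A : Matrix (Fin nx) (Fin nx) ℝ}
    {B : Matrix (Fin nx) (Fin ny) ℝ} {D : Matrix (Fin ny) (Fin ny) ℝ}
    (hM : (Matrix.fromBlocks A B Bᴴ D).IsHermitian) (hD : (-D).PosDef)
    (hS : (A - B * D⁻¹ * Bᴴ).PosDef) :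
    HasInertia (Matrix.fromBlocks A B Bᴴ D) (nx, ny, 0) := by
  have hDh : D.IsHermitian := by simpa using hD.1.neg
  have : Invertible D := (by simpa using hD.isUnit.neg : IsUnit D).invertible
  let e := (LinearEquiv.sumArrowLequivProdArrow (Fin nx) (Fin ny) ℝ ℝ).symm.toLinearMap
  refine hasInertia_of_definite hM (by simp)
    (e ∘ₗ LinearMap.prod LinearMap.id (-(D⁻¹ * Bᴴ).mulVecLin)) (fun u hu => ?_)
    (e ∘ₗ LinearMap.inr ℝ _ _) (fun w hw => ?_)
  · have h := schur_complement_eq₂₂ A B u (-((D⁻¹ * Bᴴ) *ᵥ u)) hDh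
    rw [star_trivial, ← dotProduct_mulVec, add_neg_cancel] at h
    simp only [star_trivial, zero_vecMul, zero_dotProduct, zero_add, ← dotProduct_mulVec] at h
    exact (hS.dotProduct_mulVec_pos hu).trans_eq h.symm
  · have h := schur_complement_eq₂₂ A B 0 w hDh
    rw [star_trivial, ← dotProduct_mulVec] at h
    simp only [star_trivial, mulVec_zero, zero_add, zero_vecMul, zero_dotProduct, add_zero,
      ← dotProduct_mulVec] at h
    refine h.trans_lt ?_
    simpa [neg_mulVec] using hD.dotProduct_mulVec_pos hw

theorem hasInertia_of_neg_posDef {D : Matrix (Fin ny) (Fin ny) ℝ} (hD : (-D).PosDef) :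
    HasInertia D (0, ny, 0) := by
  refine hasInertia_of_definite (by simpa using hD.1.neg) (by simp) 0
    (fun u hu => (hu (Subsingleton.elim _ _)).elim) LinearMap.id fun w hw => ?_
  simpa [neg_mulVec] using hD.dotProduct_mulVec_pos hw

theorem fderiv_eq_zero_of_gradient_eq_zero {E : Type*} [NormedAddCommGroup E]
    [InnerProductSpace ℝ E] [CompleteSpace E] {F : E → ℝ} {x : E} (h : gradient F x = 0) :
    fderiv ℝ F x = 0 := by
  simpa [gradient] using h

/-- At a critical local minmax point, `∇ᵧᵧf` is negative semidefinite; hence negative definite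
when invertible. -/
theorem neg_Hyy_posDef_of_isLocalMinMax
    {f : EuclideanSpace ℝ (Fin nx) → EuclideanSpace ℝ (Fin ny) → ℝ}
    (hf : ContDiff ℝ 2 (fun p : EuclideanSpace ℝ (Fin nx) × EuclideanSpace ℝ (Fin ny) =>
      f p.1 p.2))
    {xs : EuclideanSpace ℝ (Fin nx)} {ys : EuclideanSpace ℝ (Fin ny)}
    (hcrit : fderiv ℝ (fun p : EuclideanSpace ℝ (Fin nx) × EuclideanSpace ℝ (Fin ny) =>
      f p.1 p.2) (xs, ys) = 0)
    (hinvyy : IsUnit (Hyy f xs ys).det) (hminmax : IsLocalMinMax f xs ys) :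
    (-Hyy f xs ys).PosDef := by
  have hH := Hzz_isHermitian hf (xs, ys)
  have hherm : (Hyy f xs ys).IsHermitian := (isHermitian_fromBlocks_iff.1 hH).2.2.2
  have hq : ∀ w, w ⬝ᵥ Hyy f xs ys *ᵥ w = fderiv ℝ (fderiv ℝ (fun p => f p.1 p.2)) (xs, ys)
      (0, WithLp.toLp 2 w) (0, WithLp.toLp 2 w) := by
    intro w
    have hw : sumCoordEquiv nx ny (Sum.elim 0 w) = (0, WithLp.toLp 2 w) := rfl
    have := dotProduct_Hzz_mulVec hf (xs, ys) (Sum.elim 0 w) (Sum.elim 0 w)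
    rw [hw] at this
    simpa [Hzz, fromBlocks_mulVec] using this
  have hsemi : (-Hyy f xs ys).PosSemidef := by
    refine .of_dotProduct_mulVec_nonneg hherm.neg fun w => ?_
    rw [neg_mulVec, dotProduct_neg, star_trivial, hq]
    by_contra! hpos
    rw [neg_lt_zero] at hpos
    set W : EuclideanSpace ℝ (Fin nx) × EuclideanSpace ℝ (Fin ny) := (0, WithLp.toLp 2 w)
    have hlt := eventually_lt_of_fderiv_fderiv_neg hf.neg (z := (xs, ys))
      (by rw [fderiv_fun_neg, hcrit, neg_zero]) (ContinuousLinearMap.toSpanSingleton ℝ W)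
      (fun t ht => by
        have : fderiv ℝ (fun p : EuclideanSpace ℝ (Fin nx) × EuclideanSpace ℝ (Fin ny) =>
            -f p.1 p.2) = fun p => -fderiv ℝ (fun p => f p.1 p.2) p := by
          funext p
          exact fderiv_fun_neg
        rw [this, fderiv_fun_neg]
        simp only [ContinuousLinearMap.toSpanSingleton_apply, map_smul, _root_.neg_apply,
          _root_.smul_apply, smul_eq_mul]
        have := mul_pos (mul_self_pos.2 ht) hpos
        linarith)
    obtain ⟨δ₀, hδ₀, h, hpos', -, hle⟩ := hminmax
    have hnear : ∀ᶠ t : ℝ in 𝓝 0, ‖t • WithLp.toLp 2 w‖ < h δ₀ := by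
      have hc : Continuous fun t : ℝ => ‖t • WithLp.toLp 2 w‖ := by fun_prop
      refine (hc.tendsto 0).eventually_lt_const ?_
      simpa using hpos' δ₀ ⟨hδ₀, le_rfl⟩
    obtain ⟨t, ⟨ht1, ht2⟩, ht3⟩ :=
      (((hlt.and hnear).filter_mono nhdsWithin_le_nhds).and
        (self_mem_nhdsWithin : {0}ᶜ ∈ 𝓝[≠] (0 : ℝ))).exists
    have h1 := ht1 ht3
    have h2 := (hle δ₀ ⟨hδ₀, le_rfl⟩ xs (ys + t • WithLp.toLp 2 w) (by simpa using hδ₀.le)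
      (by simpa using ht2.le)).1
    simp [W] at h1 h2
    linarith
  rw [hsemi.posDef_iff_isUnit, isUnit_iff_isUnit_det, det_neg]
  exact ((isUnit_one.neg).pow _).mul hinvyy

/-- At a critical local minmax point with negative definite `∇ᵧᵧf`, the Schur complement of the
Hessian is positive semidefinite. -/
theorem schur_posSemidef_of_isLocalMinMax
    {f : EuclideanSpace ℝ (Fin nx) → EuclideanSpace ℝ (Fin ny) → ℝ}
    (hf : ContDiff ℝ 2 (fun p : EuclideanSpace ℝ (Fin nx) × EuclideanSpace ℝ (Fin ny) =>
      f p.1 p.2))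
    {xs : EuclideanSpace ℝ (Fin nx)} {ys : EuclideanSpace ℝ (Fin ny)}
    (hcrit : fderiv ℝ (fun p : EuclideanSpace ℝ (Fin nx) × EuclideanSpace ℝ (Fin ny) =>
      f p.1 p.2) (xs, ys) = 0)
    (hD : (-Hyy f xs ys).PosDef) (hminmax : IsLocalMinMax f xs ys) :
    (Hxx f xs ys - Hxy f xs ys * (Hyy f xs ys)⁻¹ * (Hxy f xs ys)ᴴ).PosSemidef := by
  obtain ⟨-, hBC, -, hDh⟩ := isHermitian_fromBlocks_iff.1 (Hzz_isHermitian hf (xs, ys))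
  have : Invertible (Hyy f xs ys) := (by simpa using hD.isUnit.neg : IsUnit _).invertible
  set S := Hxx f xs ys - Hxy f xs ys * (Hyy f xs ys)⁻¹ * (Hxy f xs ys)ᴴ
  have hSh : S.IsHermitian := (IsHermitian.fromBlocks₂₂ _ _ hDh).1 (by
    have := Hzz_isHermitian hf (xs, ys)
    rwa [Hzz, ← hBC] at this)
  refine .of_dotProduct_mulVec_nonneg hSh fun u => ?_
  rw [star_trivial]
  by_contra! hneg
  set U : EuclideanSpace ℝ (Fin nx) := WithLp.toLp 2 u
  have hU : 0 < ‖U‖ := by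
    rw [norm_pos_iff]
    rintro hU
    have : u = 0 := by simpa [U] using hU
    simp [this] at hneg
  let P : ℝ × EuclideanSpace ℝ (Fin ny) →L[ℝ]
      EuclideanSpace ℝ (Fin nx) × EuclideanSpace ℝ (Fin ny) :=
    (ContinuousLinearMap.toSpanSingleton ℝ U).prodMap (.id ℝ _)
  have hP : ∀ g, g ≠ 0 →
      fderiv ℝ (fderiv ℝ (fun p => f p.1 p.2)) (xs, ys) (P g) (P g) < 0 := by
    rintro ⟨t, w⟩ hg
    have hPg : P (t, w) = sumCoordEquiv nx ny (Sum.elim (t • u) w) := rfl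
    rw [hPg, ← dotProduct_Hzz_mulVec hf]
    have h := schur_complement_eq₂₂ (Hxx f xs ys) (Hxy f xs ys) (t • u) w hDh
    rw [star_trivial, ← dotProduct_mulVec, hBC] at h
    simp only [star_trivial, ← dotProduct_mulVec] at h
    refine h.trans_lt ?_
    have hq := hD.posSemidef.dotProduct_mulVec_nonneg
      (((Hyy f xs ys)⁻¹ * (Hyx f xs ys)) *ᵥ (t • u) + w)
    rw [star_trivial, neg_mulVec, dotProduct_neg] at hq
    rcases eq_or_ne t 0 with rfl | ht
    · have hw : w.ofLp ≠ 0 := by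
        rintro hw
        exact hg (by simpa using hw)
      have := hD.dotProduct_mulVec_pos hw
      simpa [neg_mulVec] using this
    · have h2 : (t • u) ⬝ᵥ S *ᵥ (t • u) < 0 := by
        rw [mulVec_smul, dotProduct_smul, smul_dotProduct, smul_eq_mul, smul_eq_mul, ← mul_assoc]
        exact mul_neg_of_pos_of_neg (mul_self_pos.2 ht) hneg
      rw [← hBC] at hq ⊢
      change _ + (t • u) ⬝ᵥ S *ᵥ (t • u) < 0
      linarith
  obtain ⟨r, hr, hball⟩ := Metric.eventually_nhds_iff_ball.1
    (eventually_lt_of_fderiv_fderiv_neg hf hcrit P hP)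
  obtain ⟨δ₀, hδ₀, h, hpos, hlim, hle⟩ := hminmax
  have hev : ∀ᶠ δ in 𝓝[>] (0 : ℝ), δ < δ₀ ∧ δ < r * ‖U‖ :=
    ((eventually_lt_nhds hδ₀).and (eventually_lt_nhds (by positivity))).filter_mono
      nhdsWithin_le_nhds
  obtain ⟨δ, ⟨⟨hδ1, hδ2⟩, hδ3⟩, hδ⟩ :=
    ((hev.and (hlim.eventually_lt_const hr)).and self_mem_nhdsWithin).exists
  replace hδ : 0 < δ := hδ
  obtain ⟨-, yt, hyt, hge⟩ := hle δ ⟨hδ, hδ1.le⟩ (xs + (δ / ‖U‖) • U) ys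
    (by simp [norm_smul, abs_of_pos hδ, hU.ne']) (by simpa using (hpos δ ⟨hδ, hδ1.le⟩).le)
  have hlt := hball (δ / ‖U‖, yt - ys) (by
    rw [mem_ball_zero_iff, Prod.norm_def, max_lt_iff]
    refine ⟨?_, hyt.trans_lt hδ3⟩
    rwa [Real.norm_of_nonneg (by positivity), div_lt_iff₀ hU])
    (fun h0 => (div_pos hδ hU).ne' (congrArg Prod.fst h0))
  simp [P] at hlt
  linarith

theorem Emod_zero_zero (nx ny : ℕ) : Emod nx ny 0 0 = 0 := by
  rw [Emod, diagonal_eq_zero]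
  ext a
  cases a <;> simp

/-- The Newton iteration without modification is locally asymptotically stable at critical points
with invertible Hessian. -/
theorem isLASFixedPt_newtonMinMaxMap_zero
    {f : EuclideanSpace ℝ (Fin nx) → EuclideanSpace ℝ (Fin ny) → ℝ}
    (hf : ContDiff ℝ 2 (fun p : EuclideanSpace ℝ (Fin nx) × EuclideanSpace ℝ (Fin ny) =>
      f p.1 p.2))
    {z : EuclideanSpace ℝ (Fin nx) × EuclideanSpace ℝ (Fin ny)}
    (hcrit : fderiv ℝ (fun p : EuclideanSpace ℝ (Fin nx) × EuclideanSpace ℝ (Fin ny) =>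
      f p.1 p.2) z = 0)
    (hinv : IsUnit (Hzz f z.1 z.2).det) :
    IsLASFixedPt (newtonMinMaxMap f (fun _ => 0) (fun _ => 0)) z := by
  set L := sumCoordEquiv nx ny
  set F := fun p : EuclideanSpace ℝ (Fin nx) × EuclideanSpace ℝ (Fin ny) => f p.1 p.2
  have hT : ∀ p, newtonMinMaxMap f (fun _ => 0) (fun _ => 0) p =
      p - L ((Hzz f p.1 p.2)⁻¹ *ᵥ stackedGradient f p) := by
    intro p
    simp only [newtonMinMaxMap, Emod_zero_zero, add_zero]
    rfl
  have hgz : stackedGradient f z = 0 := by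
    ext a
    rw [stackedGradient_apply hf, hcrit]
    simp
  have hC1 : ContDiff ℝ 1 (fderiv ℝ F) := hf.fderiv_right (m := 1) (by norm_num)
  have hDcont : Continuous (fderiv ℝ (fderiv ℝ F)) := hC1.continuous_fderiv one_ne_zero
  have hHcont : Continuous fun p : EuclideanSpace ℝ (Fin nx) × EuclideanSpace ℝ (Fin ny) =>
      Hzz f p.1 p.2 := by
    refine continuous_matrix fun a b => ?_
    simp only [Hzz_apply hf]
    fun_prop
  have hHinv : ContinuousAt (fun p : EuclideanSpace ℝ (Fin nx) × EuclideanSpace ℝ (Fin ny) =>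
      (Hzz f p.1 p.2)⁻¹) z := by
    simp only [inv_def, Ring.inverse_eq_inv']
    exact (hHcont.matrix_det.continuousAt.inv₀ hinv.ne_zero).smul
      hHcont.matrix_adjugate.continuousAt
  have hDo : (fun p => fderiv ℝ F p - fderiv ℝ (fderiv ℝ F) p (p - z)) =o[𝓝 z]
      fun p => p - z := by
    simpa [hcrit] using isLittleO_sub_fderiv_sub hC1 z
  have hR : ∀ a, (fun p => (stackedGradient f p - Hzz f p.1 p.2 *ᵥ L.symm (p - z)) a) =o[𝓝 z]
      fun p => p - z := by
    intro a
    have ha : ∀ p, (stackedGradient f p - Hzz f p.1 p.2 *ᵥ L.symm (p - z)) a =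
        (fderiv ℝ F p - fderiv ℝ (fderiv ℝ F) p (p - z)) (L (Pi.single a 1)) := by
      intro p
      have h1 := dotProduct_Hzz_mulVec hf p (Pi.single a 1) (L.symm (p - z))
      rw [single_one_dotProduct, L.apply_symm_apply,
        (hf.contDiffAt.isSymmSndFDerivAt (by simp)) _ _] at h1
      rw [Pi.sub_apply, stackedGradient_apply hf, h1]
      rfl
    simp only [ha]
    exact ((ContinuousLinearMap.apply ℝ ℝ (L (Pi.single a 1))).isBigO_comp _ _).trans_isLittleO hDo
  have hMR : (fun p => (Hzz f p.1 p.2)⁻¹ *ᵥ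
      (stackedGradient f p - Hzz f p.1 p.2 *ᵥ L.symm (p - z))) =o[𝓝 z] fun p => p - z := by
    rw [Asymptotics.isLittleO_pi]
    intro a
    simp only [mulVec, dotProduct]
    refine Asymptotics.IsLittleO.fun_sum fun b _ => ?_
    have hb : (fun p : EuclideanSpace ℝ (Fin nx) × EuclideanSpace ℝ (Fin ny) =>
        (Hzz f p.1 p.2)⁻¹ a b) =O[𝓝 z] fun _ => (1 : ℝ) :=
      Tendsto.isBigO_one ℝ (((continuous_id.matrix_elem a b).continuousAt.comp hHinv).tendsto)
    simpa using (hb.mul_isLittleO (hR b).norm_right).norm_right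
  refine isLASFixedPt_of_isLittleO (by rw [Function.IsFixedPt, hT, hgz]; simp) ?_
  have hLo := ((L.toContinuousLinearMap.isBigO_comp _ _).trans_isLittleO hMR).neg_left
  refine hLo.congr' ?_ .rfl
  filter_upwards [hHcont.matrix_det.continuousAt.eventually_ne hinv.ne_zero] with p hp
  have hp' : IsUnit (Hzz f p.1 p.2).det := isUnit_iff_ne_zero.2 hp
  rw [hT, mulVec_sub, mulVec_mulVec, nonsing_inv_mul _ hp', one_mulVec]
  simp
  abel

/-- **Theorem (stability part)**: at an equilibrium that is a local minmax, there exist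
modification functions `ε_x, ε_y`, constant near the equilibrium and satisfying the LQAC,
making the equilibrium locally asymptotically stable for the modified Newton iteration. -/
theorem newtonMinMax_LAS_of_localMinMax
    (f : EuclideanSpace ℝ (Fin nx) → EuclideanSpace ℝ (Fin ny) → ℝ)
    (hf : ContDiff ℝ 2 (fun p : EuclideanSpace ℝ (Fin nx) × EuclideanSpace ℝ (Fin ny) =>
      f p.1 p.2))
    (xs : EuclideanSpace ℝ (Fin nx)) (ys : EuclideanSpace ℝ (Fin ny))
    (hgradx : gradient (fun x' => f x' ys) xs = 0)
    (hgrady : gradient (fun y' => f xs y') ys = 0)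
    (hinvzz : IsUnit (Hzz f xs ys).det)
    (hinvyy : IsUnit (Hyy f xs ys).det)
    (hHdiff : ∀ᶠ p in 𝓝 (xs, ys), ∀ i j,
      DifferentiableAt ℝ
        (fun q : EuclideanSpace ℝ (Fin nx) × EuclideanSpace ℝ (Fin ny) => Hzz f q.1 q.2 i j) p)
    (hminmax : IsLocalMinMax f xs ys) :
    ∃ εx εy : EuclideanSpace ℝ (Fin nx) × EuclideanSpace ℝ (Fin ny) → ℝ,
      (∀ p, 0 ≤ εx p) ∧ (∀ p, 0 ≤ εy p) ∧
      (∀ᶠ p in 𝓝 (xs, ys), εx p = εx (xs, ys) ∧ εy p = εy (xs, ys)) ∧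
      LQAC f εx εy (xs, ys) ∧
      IsLASFixedPt (newtonMinMaxMap f εx εy) (xs, ys) := by
  have hd := hf.differentiable two_ne_zero (xs, ys)
  have hcrit : fderiv ℝ (fun p : EuclideanSpace ℝ (Fin nx) × EuclideanSpace ℝ (Fin ny) =>
      f p.1 p.2) (xs, ys) = 0 := by
    ext v
    · simp [← fderiv_partial_fst hd, fderiv_eq_zero_of_gradient_eq_zero hgradx]
    · simp [← fderiv_partial_snd hd, fderiv_eq_zero_of_gradient_eq_zero hgrady]
  have hD := neg_Hyy_posDef_of_isLocalMinMax hf hcrit hinvyy hminmax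
  have hS := schur_posSemidef_of_isLocalMinMax hf hcrit hD hminmax
  have hH := Hzz_isHermitian hf (xs, ys)
  have hBC : (Hxy f xs ys)ᴴ = Hyx f xs ys := (isHermitian_fromBlocks_iff.1 hH).2.1
  have hblocks : Hzz f xs ys =
      Matrix.fromBlocks (Hxx f xs ys) (Hxy f xs ys) (Hxy f xs ys)ᴴ (Hyy f xs ys) := by
    rw [hBC, Hzz]
  have hSpos : (Hxx f xs ys - Hxy f xs ys * (Hyy f xs ys)⁻¹ * (Hxy f xs ys)ᴴ).PosDef := by
    have := invertibleOfIsUnitDet _ hinvyy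
    rw [hblocks, det_fromBlocks₂₂, invOf_eq_nonsing_inv] at hinvzz
    exact hS.posDef_iff_det_ne_zero.2 (right_ne_zero_of_mul hinvzz.ne_zero)
  refine ⟨fun _ => 0, fun _ => 0, fun _ => le_rfl, fun _ => le_rfl, by simp, ⟨?_, ?_⟩,
    isLASFixedPt_newtonMinMaxMap_zero hf hcrit hinvzz⟩
  · simpa using hasInertia_of_neg_posDef hD
  · rw [Emod_zero_zero, add_zero]
    change HasInertia (Hzz f xs ys) _
    rw [hblocks]
    exact hasInertia_fromBlocks_of_schur (hblocks ▸ hH) hD hSpos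
end
end
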